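/- arXiv:2102.00526 — 2 statements merged into one kernel-verified Lean document; each statement's English description precedes it below -/
import Mathlib

section
/- There is no first-order sentence φ in the first-order language with a single binary relation symbol ≤ (and equality) such that for every finite partially ordered set S: S satisfies φ if and only if S is order-isomorphic to the partially ordered set J(Con L) of join-irreducible congruences of some slim semimodular lattice L. Equivalently, the class of ordered sets of join-irreducible congruences of slim semimodular lattices is not finitely axiomatizable modulo finiteness. -/
open FirstOrder

section LatticeDefs

variable {α : Type*} [Lattice α] [OrderBot α]

/-- An element of a lattice with least element `⊥` is *join-irreducible* if it is not the
least element and `x = y ⊔ z` implies `x = y` or `x = z`. -/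
def JoinIrred (x : α) : Prop :=
  x ≠ ⊥ ∧ ∀ y z : α, x = y ⊔ z → x = y ∨ x = z

variable (α) in
/-- The set of maximal elements of the poset of join-irreducible elements. -/
def maxJI : Set α :=
  {a | JoinIrred a ∧ ∀ b : α, JoinIrred b → a ≤ b → a = b}

/-- `c` is covered by `a` in the poset of join-irreducible elements. -/
def JCovBy (c a : α) : Prop :=
  JoinIrred c ∧ JoinIrred a ∧ c < a ∧ ∀ d : α, JoinIrred d → c < d → d < a → False

variable (α) in
/-- The *Two-cover Property*: every join-irreducible element has at most two covers in the
poset of join-irreducible elements. -/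
def TwoCoverProperty : Prop :=
  ∀ x y z w : α, JCovBy x y → JCovBy x z → JCovBy x w → y = z ∨ y = w ∨ z = w

variable (α) in
/-- The *Bipartite Maximal Elements Property*: the set of maximal join-irreducible elements
is the disjoint union of two nonempty subsets such that no two distinct elements of the same
subset have a common lower cover in the poset of join-irreducible elements. -/
def BipartiteMaxElements : Prop :=
  ∃ A B : Set α, A.Nonempty ∧ B.Nonempty ∧ Disjoint A B ∧ A ∪ B = maxJI α ∧
    (∀ a ∈ A, ∀ b ∈ A, a ≠ b → ¬∃ c : α, JCovBy c a ∧ JCovBy c b) ∧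
    (∀ a ∈ B, ∀ b ∈ B, a ≠ b → ¬∃ c : α, JCovBy c a ∧ JCovBy c b)

/-- A *cyclic element*: the join of pairwise distinct maximal join-irreducible elements
`a 0, …, a (n-1)` (`n ≥ 3`) such that for `i < j`, some join-irreducible element lies below
both `a i` and `a j` if and only if `j = i + 1` or `(i, j) = (0, n - 1)`. -/
def IsCyclicElem (x : α) : Prop :=
  ∃ n : ℕ, 3 ≤ n ∧ ∃ a : Fin n → α, Function.Injective a ∧ (∀ i, a i ∈ maxJI α) ∧
    x = Finset.univ.sup a ∧
    ∀ i j : Fin n, i < j →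
      ((∃ c : α, JoinIrred c ∧ c ≤ a i ∧ c ≤ a j) ↔
        ((j : ℕ) = (i : ℕ) + 1 ∨ ((i : ℕ) = 0 ∧ (j : ℕ) = n - 1)))

/-- A *V-set* of `x`: a two-element subset of `maxJI α ∩ ↓x` whose two elements have a
common join-irreducible lower bound. -/
def IsVSet (x : α) (S : Set α) : Prop :=
  ∃ a₀ a₁ : α, a₀ ≠ a₁ ∧ S = {a₀, a₁} ∧ a₀ ∈ maxJI α ∧ a₁ ∈ maxJI α ∧ a₀ ≤ x ∧ a₁ ≤ x ∧
    ∃ c : α, JoinIrred c ∧ c ≤ a₀ ∧ c ≤ a₁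

/-- A *W-set* of `x`: a four-element subset `{a 0, a 1, a 2, a 3}` of `maxJI α ∩ ↓x` such
that for `i < j`, some join-irreducible element lies below both `a i` and `a j` if and only
if `j = i + 1`. -/
def IsWSet (x : α) (S : Set α) : Prop :=
  ∃ a : Fin 4 → α, Function.Injective a ∧ S = Set.range a ∧
    (∀ i, a i ∈ maxJI α ∧ a i ≤ x) ∧
    ∀ i j : Fin 4, i < j →
      ((∃ c : α, JoinIrred c ∧ c ≤ a i ∧ c ≤ a j) ↔ (j : ℕ) = (i : ℕ) + 1)

/-- A *VW-element*: a nonzero element `x` which is the join of `maxJI α ∩ ↓x`, such that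
each element of `maxJI α ∩ ↓x` either belongs to a unique V-set of `x` and to no W-set of
`x`, or belongs to a unique W-set of `x` and to no V-set of `x`. -/
def IsVWElem (x : α) : Prop :=
  x ≠ ⊥ ∧ IsLUB (maxJI α ∩ Set.Iic x) x ∧
    ∀ y ∈ maxJI α ∩ Set.Iic x,
      ((∃! S : Set α, IsVSet x S ∧ y ∈ S) ∧ ¬∃ S : Set α, IsWSet x S ∧ y ∈ S) ∨
      ((∃! S : Set α, IsWSet x S ∧ y ∈ S) ∧ ¬∃ S : Set α, IsVSet x S ∧ y ∈ S)

variable (α) in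
/-- The *Decomposable Cyclic Elements Property*: each cyclic element `x` is the join of two
VW-elements `y`, `z` with `maxJI α ∩ ↓y ∩ ↓z = ∅`. -/
def DecomposableCyclicElements : Prop :=
  ∀ x : α, IsCyclicElem x →
    ∃ y z : α, IsVWElem y ∧ IsVWElem z ∧ x = y ⊔ z ∧
      maxJI α ∩ Set.Iic y ∩ Set.Iic z = ∅

end LatticeDefs

/-- A *congruence* of a lattice: an equivalence relation compatible with `⊔` and `⊓`. -/
structure LatCon (L : Type*) [Lattice L] where
  r : L → L → Prop
  refl' : ∀ a, r a a
  symm' : ∀ a b, r a b → r b a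
  trans' : ∀ a b c, r a b → r b c → r a c
  sup' : ∀ a b c d, r a b → r c d → r (a ⊔ c) (b ⊔ d)
  inf' : ∀ a b c d, r a b → r c d → r (a ⊓ c) (b ⊓ d)

namespace LatCon

variable {L : Type*} [Lattice L]

theorem ext' {θ φ : LatCon L} (h : θ.r = φ.r) : θ = φ := by
  cases θ; cases φ; cases h; rfl

/-- Congruences are ordered by inclusion. -/
instance : PartialOrder (LatCon L) where
  le θ φ := ∀ a b, θ.r a b → φ.r a b
  le_refl _ _ _ h := h
  le_trans _ _ _ h₁ h₂ a b h := h₂ a b (h₁ a b h)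
  le_antisymm θ φ h₁ h₂ := ext' (funext fun a => funext fun b => propext ⟨h₁ a b, h₂ a b⟩)

instance : InfSet (LatCon L) :=
  ⟨fun S =>
    { r := fun a b => ∀ θ ∈ S, θ.r a b
      refl' := fun a θ _ => θ.refl' a
      symm' := fun a b h θ hθ => θ.symm' a b (h θ hθ)
      trans' := fun a b c h₁ h₂ θ hθ => θ.trans' a b c (h₁ θ hθ) (h₂ θ hθ)
      sup' := fun a b c d h₁ h₂ θ hθ => θ.sup' a b c d (h₁ θ hθ) (h₂ θ hθ)
      inf' := fun a b c d h₁ h₂ θ hθ => θ.inf' a b c d (h₁ θ hθ) (h₂ θ hθ) }⟩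

/-- The congruences of a lattice form a complete lattice (with joins of congruences computed
as joins of equivalence relations). -/
instance : CompleteLattice (LatCon L) :=
  completeLatticeOfInf _ fun _ =>
    ⟨fun θ hθ a b h => h θ hθ, fun _ hψ a b h θ hθ => hψ hθ a b h⟩

end LatCon

/-- A lattice is *semimodular* if `x ⋖ y` implies `x ⊔ z ⋖ y ⊔ z` or `x ⊔ z = y ⊔ z`. -/
def Semimodular (L : Type*) [Lattice L] : Prop :=
  ∀ x y z : L, x ⋖ y → (x ⊔ z ⋖ y ⊔ z ∨ x ⊔ z = y ⊔ z)

/-- A lattice is *slim* if the poset of its join-irreducible elements is the union of two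
chains. -/
def Slim (L : Type*) [Lattice L] [OrderBot L] : Prop :=
  ∃ C₁ C₂ : Set L, IsChain (· ≤ ·) C₁ ∧ IsChain (· ≤ ·) C₂ ∧
    {x : L | JoinIrred x} = C₁ ∪ C₂

/-- A bundled slim semimodular lattice (slim lattices are finite by definition). -/
structure SlimSemimodularLattice where
  carrier : Type
  [latt : Lattice carrier]
  [bot : OrderBot carrier]
  [fin : Fintype carrier]
  slim : Slim carrier
  semimodular : Semimodular carrier

attribute [instance] SlimSemimodularLattice.latt SlimSemimodularLattice.bot
  SlimSemimodularLattice.fin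

/-! ### Quadrant systems of planar point sets -/

namespace SlimQuad

variable {ι : Type*}

/-- `A` is closed under the north-east hull: it is the set of points in a quadrant. -/
def HC (x y : ι → ℕ) (A : Set ι) : Prop :=
  ∀ p, (∃ t ∈ A, x t ≤ x p) → (∃ t ∈ A, y t ≤ y p) → p ∈ A

/-- Points strictly north-east of `p`. -/
def NE (x y : ι → ℕ) (p : ι) : Set ι := {s | x p < x s ∧ y p < y s}

/-- `p` has both a north-west and a south-east point. -/
def Mid (x y : ι → ℕ) (p : ι) : Prop :=
  (∃ a, x a < x p ∧ y p < y a) ∧ (∃ a, x p < x a ∧ y a < y p)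

/-- Collapsing `q` forces collapsing `p` in one step. -/
def Step (x y : ι → ℕ) (q p : ι) : Prop :=
  q ≠ p ∧ Mid x y p ∧ q ∉ NE x y p ∧ HC x y (insert q (NE x y p))

/-- The hull. -/
def hull (x y : ι → ℕ) (A : Set ι) : Set ι :=
  {p | (∃ t ∈ A, x t ≤ x p) ∧ (∃ t ∈ A, y t ≤ y p)}

/-- The points which are not strictly south or west of `p`. -/
def Qd (x y : ι → ℕ) (p : ι) : Set ι := {s | x p ≤ x s ∧ y p ≤ y s}

variable {x y : ι → ℕ}

theorem HC.swap {A : Set ι} (h : HC x y A) : HC y x A := fun p h1 h2 => h p h2 h1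

theorem NE_swap (p : ι) : NE y x p = NE x y p := by
  ext s; exact and_comm

theorem Mid.swap {p : ι} (h : Mid x y p) : Mid y x p := by
  obtain ⟨⟨a, h1, h2⟩, b, h3, h4⟩ := h
  exact ⟨⟨b, h4, h3⟩, a, h2, h1⟩

theorem Step.swap {q p : ι} (h : Step x y q p) : Step y x q p := by
  obtain ⟨h1, h2, h3, h4⟩ := h
  exact ⟨h1, h2.swap, by rwa [NE_swap], by rw [NE_swap]; exact h4.swap⟩

theorem hc_hull (A : Set ι) : HC x y (hull x y A) := by
  rintro p ⟨t, ⟨⟨a, ha, h1⟩, -⟩, h2⟩ ⟨s, ⟨-, b, hb, h3⟩, h4⟩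
  exact ⟨⟨a, ha, h1.trans h2⟩, b, hb, h3.trans h4⟩

theorem subset_hull (A : Set ι) : A ⊆ hull x y A :=
  fun a ha => ⟨⟨a, ha, le_rfl⟩, a, ha, le_rfl⟩

theorem hull_subset {A B : Set ι} (hB : HC x y B) (h : A ⊆ B) : hull x y A ⊆ B := by
  rintro p ⟨⟨a, ha, h1⟩, b, hb, h2⟩
  exact hB p ⟨a, h ha, h1⟩ ⟨b, h hb, h2⟩

theorem HC.inter {A B : Set ι} (hA : HC x y A) (hB : HC x y B) : HC x y (A ∩ B) := by
  rintro p ⟨t, ht, h1⟩ ⟨s, hs, h2⟩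
  exact ⟨hA p ⟨t, ht.1, h1⟩ ⟨s, hs.1, h2⟩, hB p ⟨t, ht.2, h1⟩ ⟨s, hs.2, h2⟩⟩

theorem hc_NE (p : ι) : HC x y (NE x y p) := by
  rintro s ⟨t, ht, h1⟩ ⟨t', ht', h2⟩
  exact ⟨ht.1.trans_le h1, ht'.2.trans_le h2⟩

theorem hc_Qd (p : ι) : HC x y (Qd x y p) := by
  rintro s ⟨t, ht, h1⟩ ⟨t', ht', h2⟩
  exact ⟨ht.1.trans h1, ht'.2.trans h2⟩

theorem mem_Qd_iff (hx : Function.Injective x) (hy : Function.Injective y) {p s : ι} :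
    s ∈ Qd x y p ↔ s = p ∨ s ∈ NE x y p := by
  constructor
  · rintro ⟨h1, h2⟩
    rcases h1.lt_or_eq with h1 | h1
    · rcases h2.lt_or_eq with h2 | h2
      · exact Or.inr ⟨h1, h2⟩
      · exact Or.inl (hy h2).symm
    · exact Or.inl (hx h1).symm
  · rintro (rfl | ⟨h1, h2⟩)
    · exact ⟨le_rfl, le_rfl⟩
    · exact ⟨h1.le, h2.le⟩

/-- A point outside a hull-closed subset can be removed. -/
theorem exists_removable [Finite ι] (hx : Function.Injective x) (hy : Function.Injective y)
    {A B : Set ι} (hA : HC x y A) (hB : HC x y B) (h : A ⊆ B)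
    (hne : A ≠ B) : ∃ q ∈ B, q ∉ A ∧ HC x y (B \ {q}) := by
  have hBn : B.Nonempty := by
    by_contra hB0
    rw [Set.not_nonempty_iff_eq_empty] at hB0
    subst hB0
    exact hne (Set.subset_empty_iff.1 h)
  obtain ⟨a, ha, hamin⟩ := Set.exists_min_image B x B.toFinite hBn
  obtain ⟨b, hb, hbmin⟩ := Set.exists_min_image B y B.toFinite hBn
  by_cases haA : a ∈ A
  · by_cases hbA : b ∈ A
    · exact absurd (Set.Subset.antisymm h
        fun p hp => hA p ⟨a, haA, hamin p hp⟩ ⟨b, hbA, hbmin p hp⟩) hne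
    · refine ⟨b, hb, hbA, ?_⟩
      rintro p ⟨t, ht, h1⟩ ⟨t', ht', h2⟩
      refine ⟨hB p ⟨t, ht.1, h1⟩ ⟨t', ht'.1, h2⟩, ?_⟩
      rintro rfl
      exact ht'.2 (hy (le_antisymm h2 (hbmin _ ht'.1)))
  · refine ⟨a, ha, haA, ?_⟩
    rintro p ⟨t, ht, h1⟩ ⟨t', ht', h2⟩
    refine ⟨hB p ⟨t, ht.1, h1⟩ ⟨t', ht'.1, h2⟩, ?_⟩
    rintro rfl
    exact ht.2 (hx (le_antisymm h1 (hamin _ ht.1)))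

/-- Key lemma, asymmetric version. -/
theorem closed_aux [Finite ι] (hx : Function.Injective x) (hy : Function.Injective y)
    {A B D T : Set ι} (hB : HC x y B) (hD : HC x y D) (hAD : A ⊆ D)
    (hT : ∀ q p, q ∈ T → Step x y q p → p ∈ T) (hBA : ∀ p ∈ B, p ∉ A → p ∈ T)
    {q d : ι} (hq : q ∈ B) (hd : d ∈ D) :
    ∀ n : ℕ, ∀ p, x p = n → p ∉ D → x q ≤ x p → y d ≤ y p → p ∈ T := by
  intro n
  induction n using Nat.strong_induction_on with
  | _ n ih =>
  intro p hpn hpD hqp hdp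
  by_cases hpB : p ∈ B
  · exact hBA p hpB fun h => hpD (hAD h)
  have hBy : ∀ t ∈ B, y p < y t := by
    intro t ht
    by_contra hlt
    exact hpB (hB p ⟨q, hq, hqp⟩ ⟨t, ht, not_lt.1 hlt⟩)
  have hDx : ∀ t ∈ D, x p < x t := by
    intro t ht
    by_contra hlt
    exact hpD (hD p ⟨t, ht, not_lt.1 hlt⟩ ⟨d, hd, hdp⟩)
  have hqp' : x q < x p := by
    refine lt_of_le_of_ne hqp fun h => ?_
    exact hpB (hx h ▸ hq)
  have hdp' : y d < y p := by
    refine lt_of_le_of_ne hdp fun h => ?_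
    exact hpD (hy h ▸ hd)
  set U : Set ι := {s | x q ≤ x s ∧ x s < x p ∧ ∃ t ∈ insert q (NE x y p), y t ≤ y s} with hU
  have hqU : q ∈ U := ⟨le_rfl, hqp', q, Set.mem_insert _ _, le_rfl⟩
  have hlow : ∀ t ∈ insert q (NE x y p), y p < y t := by
    rintro t (rfl | ht)
    · exact hBy _ hq
    · exact ht.2
  obtain ⟨s, hs, hsmax⟩ := Set.exists_max_image U x U.toFinite ⟨q, hqU⟩
  obtain ⟨hs1, hs2, t, ht, hts⟩ := hs
  have hps : y p < y s := (hlow t ht).trans_le hts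
  have hsT : s ∈ T := by
    refine ih (x s) (hpn ▸ hs2) s rfl ?_ hs1 (hdp'.le.trans hps.le)
    intro hsD
    exact absurd (hDx s hsD) (not_lt.2 hs2.le)
  refine hT s p hsT ⟨?_, ⟨⟨q, hqp', hBy q hq⟩, d, hDx d hd, hdp'⟩, ?_, ?_⟩
  · rintro rfl
    exact lt_irrefl _ hs2
  · intro h
    exact absurd h.1 (not_lt.2 hs2.le)
  · rintro r ⟨a, ha, har⟩ ⟨b, hb, hbr⟩
    have hsr : x s ≤ x r := by
      rcases ha with rfl | ha
      · exact har
      · exact (hs2.trans (ha.1.trans_le har)).le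
    have hlow' : ∃ t ∈ insert q (NE x y p), y t ≤ y r := by
      rcases hb with rfl | hb
      · exact ⟨t, ht, hts.trans hbr⟩
      · exact ⟨b, Or.inr hb, hbr⟩
    have hpr : y p < y r := by
      obtain ⟨t', h1, h2⟩ := hlow'
      exact (hlow t' h1).trans_le h2
    rcases lt_trichotomy (x r) (x p) with h | h | h
    · left
      exact hx (le_antisymm (hsmax r ⟨hs1.trans hsr, h, hlow'⟩) hsr)
    · exact absurd hpr (by rw [hx h]; exact lt_irrefl _)
    · exact Or.inr ⟨h, hpr⟩

theorem closed_main [Finite ι] (hx : Function.Injective x) (hy : Function.Injective y)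
    {A B D T : Set ι} (hB : HC x y B) (hD : HC x y D) (hAD : A ⊆ D)
    (hT : ∀ q p, q ∈ T → Step x y q p → p ∈ T) (hBA : ∀ p ∈ B, p ∉ A → p ∈ T)
    {p : ι} (hp : p ∈ hull x y (B ∪ D)) (hpD : p ∉ D) : p ∈ T := by
  obtain ⟨⟨a, ha, hap⟩, b, hb, hbp⟩ := hp
  rcases ha with ha | ha
  · rcases hb with hb | hb
    · exact hBA p (hB p ⟨a, ha, hap⟩ ⟨b, hb, hbp⟩) fun h => hpD (hAD h)
    · exact closed_aux hx hy hB hD hAD hT hBA ha hb _ p rfl hpD hap hbp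
  · rcases hb with hb | hb
    · exact closed_aux hy hx hB.swap hD.swap hAD (fun q p hq h => hT q p hq h.swap) hBA hb ha
        _ p rfl hpD hbp hap
    · exact absurd (hD p ⟨a, ha, hap⟩ ⟨b, hb, hbp⟩) hpD

/-! ### Lattices represented by quadrant systems -/

/-- `L` is dually isomorphic, via `f`, to the lattice of hull-closed sets. -/
structure Rep {L : Type*} [Lattice L] (x y : ι → ℕ) (f : L → Set ι) : Prop where
  le_iff : ∀ u v, u ≤ v ↔ f v ⊆ f u
  hc : ∀ u, HC x y (f u)
  surj : ∀ A, HC x y A → ∃ u, f u = A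

section rep
variable {L : Type*} [Lattice L] {f : L → Set ι}

theorem Rep.inj (R : Rep x y f) {u v : L} (h : f u = f v) : u = v :=
  le_antisymm ((R.le_iff _ _).2 h.ge) ((R.le_iff _ _).2 h.le)

theorem Rep.sup (R : Rep x y f) (u v : L) : f (u ⊔ v) = f u ∩ f v := by
  obtain ⟨w, hw⟩ := R.surj _ ((R.hc u).inter (R.hc v))
  apply Set.Subset.antisymm
  · exact Set.subset_inter ((R.le_iff _ _).1 le_sup_left) ((R.le_iff _ _).1 le_sup_right)
  · rw [← hw]
    refine (R.le_iff _ _).1 (sup_le ((R.le_iff _ _).2 ?_) ((R.le_iff _ _).2 ?_)) <;> rw [hw]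
    · exact Set.inter_subset_left
    · exact Set.inter_subset_right

theorem Rep.inf (R : Rep x y f) (u v : L) : f (u ⊓ v) = hull x y (f u ∪ f v) := by
  obtain ⟨w, hw⟩ := R.surj _ (hc_hull (x := x) (y := y) (f u ∪ f v))
  apply Set.Subset.antisymm
  · rw [← hw]
    refine (R.le_iff _ _).1 (le_inf ((R.le_iff _ _).2 ?_) ((R.le_iff _ _).2 ?_)) <;> rw [hw]
    · exact Set.subset_union_left.trans (subset_hull _)
    · exact Set.subset_union_right.trans (subset_hull _)
  · exact hull_subset (R.hc _) (Set.union_subset ((R.le_iff _ _).1 inf_le_left)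
      ((R.le_iff _ _).1 inf_le_right))

/-- Closed sets of points. -/
def Clo (x y : ι → ℕ) (T : Set ι) : Prop := ∀ q p, q ∈ T → Step x y q p → p ∈ T

theorem hull_agree [Finite ι] (hx : Function.Injective x) (hy : Function.Injective y)
    {A B C T : Set ι} (hA : HC x y A) (hB : HC x y B) (hT : Clo x y T)
    (h : ∀ p ∉ T, p ∈ B → p ∈ A) {p : ι} (hp : p ∉ T)
    (hpB : p ∈ hull x y (B ∪ C)) : p ∈ hull x y (A ∪ C) := by
  by_contra hn
  refine hp (closed_main (A := A ∩ B) (B := B) (D := hull x y (A ∪ C)) hx hy hB (hc_hull _)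
    ?_ hT ?_ ?_ hn)
  · exact fun s hs => subset_hull _ (Or.inl hs.1)
  · intro s hs hsA
    by_contra hsT
    exact hsA ⟨h s hsT hs, hs⟩
  · obtain ⟨⟨a, ha, hap⟩, b, hb, hbp⟩ := hpB
    refine ⟨⟨a, ?_, hap⟩, b, ?_, hbp⟩
    · exact ha.imp id fun h => subset_hull _ (Or.inr h)
    · exact hb.imp id fun h => subset_hull _ (Or.inr h)

/-- The congruence belonging to a closed set. -/
def conOf [Finite ι] (hx : Function.Injective x) (hy : Function.Injective y)
    (R : Rep x y f) (T : Set ι) (hT : Clo x y T) : LatCon L where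
  r u v := ∀ p ∉ T, (p ∈ f u ↔ p ∈ f v)
  refl' _ _ _ := Iff.rfl
  symm' _ _ h p hp := (h p hp).symm
  trans' _ _ _ h1 h2 p hp := (h1 p hp).trans (h2 p hp)
  sup' a b c d h1 h2 p hp := by
    rw [R.sup, R.sup]
    exact and_congr (h1 p hp) (h2 p hp)
  inf' a b c d h1 h2 p hp := by
    have key : ∀ a b c d : L, (∀ p ∉ T, (p ∈ f a ↔ p ∈ f b)) → (∀ p ∉ T, (p ∈ f c ↔ p ∈ f d)) →
        p ∈ hull x y (f a ∪ f c) → p ∈ hull x y (f b ∪ f d) := by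
      intro a b c d h1 h2 h
      have h3 := hull_agree hx hy (R.hc b) (R.hc a) hT (fun p hp h => (h1 p hp).1 h) hp h
      rw [Set.union_comm] at h3
      have h4 := hull_agree hx hy (R.hc d) (R.hc c) hT (fun p hp h => (h2 p hp).1 h) hp h3
      rwa [Set.union_comm] at h4
    rw [R.inf, R.inf]
    exact ⟨key a b c d h1 h2, key b a d c (fun p hp => (h1 p hp).symm)
      (fun p hp => (h2 p hp).symm)⟩

/-- The set of points collapsed by a congruence. -/
def col (f : L → Set ι) (θ : LatCon L) : Set ι := {p | ∃ u v, θ.r u v ∧ p ∈ f u ∧ p ∉ f v}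

theorem col_cov (hx : Function.Injective x) (hy : Function.Injective y) (R : Rep x y f)
    {θ : LatCon L} {p : ι} (hp : p ∈ col f θ) {c b : L} (hc : f c = Qd x y p)
    (hb : f b = NE x y p) : θ.r c b := by
  obtain ⟨u, v, huv, hpu, hpv⟩ := hp
  have h1 := θ.inf' _ _ _ _ (θ.sup' _ _ _ _ huv (θ.refl' c)) (θ.refl' b)
  have e1 : (u ⊔ c) ⊓ b = c := by
    apply R.inj
    rw [R.inf, R.sup, hc, hb]
    apply Set.Subset.antisymm
    · refine hull_subset (hc_Qd _) (Set.union_subset Set.inter_subset_right ?_)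
      exact fun s hs => (mem_Qd_iff hx hy).2 (Or.inr hs)
    · intro s hs
      refine subset_hull _ (Or.inl ⟨?_, hs⟩)
      exact R.hc u s ⟨p, hpu, hs.1⟩ ⟨p, hpu, hs.2⟩
  have e2 : (v ⊔ c) ⊓ b = b := by
    apply R.inj
    rw [R.inf, R.sup, hc, hb]
    apply Set.Subset.antisymm
    · refine hull_subset (hc_NE _) (Set.union_subset ?_ le_rfl)
      rintro s ⟨hs1, hs2⟩
      rcases (mem_Qd_iff hx hy).1 hs2 with rfl | h
      · exact absurd hs1 hpv
      · exact h
    · exact Set.subset_union_right.trans (subset_hull _)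
  rwa [e1, e2] at h1

theorem col_spec [Finite ι] (hx : Function.Injective x) (hy : Function.Injective y)
    (R : Rep x y f) {θ : LatCon L} {u v : L} :
    θ.r u v ↔ ∀ p ∉ col f θ, (p ∈ f u ↔ p ∈ f v) := by
  constructor
  · intro h p hp
    constructor
    · intro h1
      by_contra h2
      exact hp ⟨u, v, h, h1, h2⟩
    · intro h1
      by_contra h2
      exact hp ⟨v, u, θ.symm' _ _ h, h1, h2⟩
  · have key : ∀ n : ℕ, ∀ u v : L, (f u \ f v).ncard = n → f v ⊆ f u →
        (∀ p ∉ col f θ, (p ∈ f u → p ∈ f v)) → θ.r u v := by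
      intro n
      induction n with
      | zero =>
        intro u v hn hvu _
        have : f u = f v := by
          apply Set.Subset.antisymm _ hvu
          rw [Set.ncard_eq_zero] at hn
          exact Set.diff_eq_empty.1 hn
        rw [R.inj this]
        exact θ.refl' _
      | succ n ih =>
        intro u v hn hvu h
        have hne : f v ≠ f u := by
          intro h'
          rw [h', Set.diff_self, Set.ncard_empty] at hn
          omega
        obtain ⟨q, hqu, hqv, hq⟩ := exists_removable hx hy (R.hc v) (R.hc u) hvu hne
        obtain ⟨w, hw⟩ := R.surj _ hq
        have hqc : q ∈ col f θ := by
          by_contra hqc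
          exact hqv (h q hqc hqu)
        obtain ⟨c, hc⟩ := R.surj _ (hc_Qd (x := x) (y := y) q)
        obtain ⟨b, hb⟩ := R.surj _ (hc_NE (x := x) (y := y) q)
        have h1 := θ.inf' _ _ _ _ (col_cov hx hy R hqc hc hb) (θ.refl' w)
        have hQ : Qd x y q ⊆ f u := fun s hs => R.hc u s ⟨q, hqu, hs.1⟩ ⟨q, hqu, hs.2⟩
        have e1 : c ⊓ w = u := by
          apply R.inj
          rw [R.inf, hc, hw]
          apply Set.Subset.antisymm
          · exact hull_subset (R.hc u) (Set.union_subset hQ Set.diff_subset)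
          · intro s hs
            apply subset_hull
            by_cases hsq : s = q
            · subst hsq
              exact Or.inl ⟨le_rfl, le_rfl⟩
            · exact Or.inr ⟨hs, hsq⟩
        have e2 : b ⊓ w = w := by
          apply R.inj
          rw [R.inf, hb]
          apply Set.Subset.antisymm
          · refine hull_subset (R.hc w) (Set.union_subset ?_ le_rfl)
            intro s hs
            rw [hw]
            refine ⟨hQ ((mem_Qd_iff hx hy).2 (Or.inr hs)), ?_⟩
            rintro rfl
            exact lt_irrefl _ hs.1
          · exact Set.subset_union_right.trans (subset_hull _)
        rw [e1, e2] at h1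
        refine θ.trans' _ _ _ h1 (ih w v ?_ ?_ ?_)
        · have : f u \ f v = insert q (f w \ f v) := by
            ext s
            rw [hw]
            constructor
            · rintro ⟨h1, h2⟩
              by_cases hsq : s = q
              · exact Or.inl hsq
              · exact Or.inr ⟨⟨h1, hsq⟩, h2⟩
            · rintro (rfl | ⟨⟨h1, _⟩, h2⟩)
              · exact ⟨hqu, hqv⟩
              · exact ⟨h1, h2⟩
          rw [this, Set.ncard_insert_of_notMem (by rw [hw]; exact fun h => h.1.2 rfl)] at hn
          omega
        · rw [hw]
          exact fun s hs => ⟨hvu hs, fun h => hqv (h ▸ hs)⟩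
        · intro p hp hpw
          rw [hw] at hpw
          exact h p hp hpw.1
    intro h
    have h1 : θ.r u (u ⊔ v) := by
      refine key _ _ _ rfl ((R.le_iff _ _).1 le_sup_left) fun p hp hpu => ?_
      rw [R.sup]
      exact ⟨hpu, (h p hp).1 hpu⟩
    have h2 : θ.r v (u ⊔ v) := by
      refine key _ _ _ rfl ((R.le_iff _ _).1 le_sup_right) fun p hp hpu => ?_
      rw [R.sup]
      exact ⟨(h p hp).2 hpu, hpu⟩
    exact θ.trans' _ _ _ h1 (θ.symm' _ _ h2)

theorem Step.dir (hx : Function.Injective x) (hy : Function.Injective y) {q p : ι}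
    (h : Step x y q p) : (x q < x p ∧ y p < y q) ∨ (x p < x q ∧ y q < y p) := by
  obtain ⟨h1, -, h3, h4⟩ := h
  have hxne : x q ≠ x p := fun h => h1 (hx h)
  have hyne : y q ≠ y p := fun h => h1 (hy h)
  rcases lt_or_gt_of_ne hxne with hxl | hxl <;> rcases lt_or_gt_of_ne hyne with hyl | hyl
  · exfalso
    rcases h4 p ⟨q, Or.inl rfl, hxl.le⟩ ⟨q, Or.inl rfl, hyl.le⟩ with h | h
    · exact h1 h.symm
    · exact lt_irrefl _ h.1
  · exact Or.inl ⟨hxl, hyl⟩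
  · exact Or.inr ⟨hxl, hyl⟩
  · exact absurd ⟨hxl, hyl⟩ h3

theorem col_clo_aux [Finite ι] (hx : Function.Injective x) (hy : Function.Injective y)
    (R : Rep x y f) (θ : LatCon L) {q p : ι} (hq : q ∈ col f θ) (hqp : Step x y q p)
    (hxq : x q < x p) : p ∈ col f θ := by
  obtain ⟨h1, ⟨-, g, hg1, hg2⟩, h3, h4⟩ := hqp
  have hC : HC x y {s | x p < x s ∧ y g ≤ y s} := by
    rintro s ⟨t, ht, h1⟩ ⟨t', ht', h2⟩
    exact ⟨ht.1.trans_le h1, ht'.2.trans h2⟩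
  obtain ⟨c, hc⟩ := R.surj _ hC
  obtain ⟨b, hb⟩ := R.surj _ (hc_NE (x := x) (y := y) p)
  obtain ⟨b', hb'⟩ := R.surj _ h4
  have h5 : θ.r b' b := by
    rw [col_spec hx hy R]
    intro s hs
    rw [hb, hb']
    constructor
    · rintro (rfl | h)
      · exact absurd hq hs
      · exact h
    · exact Or.inr
  refine ⟨b' ⊓ c, b ⊓ c, θ.inf' _ _ _ _ h5 (θ.refl' c), ?_, ?_⟩
  · rw [R.inf]
    exact ⟨⟨q, Or.inl (by rw [hb']; exact Or.inl rfl), hxq.le⟩,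
      g, Or.inr (by rw [hc]; exact ⟨hg1, le_rfl⟩), hg2.le⟩
  · intro hp
    have : p ∈ f c := by
      rw [R.inf] at hp
      refine hull_subset (R.hc c) (Set.union_subset ?_ le_rfl) hp
      rw [hb, hc]
      exact fun s hs => ⟨hs.1, (hg2.trans hs.2).le⟩
    rw [hc] at this
    exact lt_irrefl _ this.1

theorem Rep.swap (R : Rep x y f) : Rep y x f :=
  ⟨R.le_iff, fun u => (R.hc u).swap, fun A hA => R.surj A hA.swap⟩

theorem col_clo [Finite ι] (hx : Function.Injective x) (hy : Function.Injective y)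
    (R : Rep x y f) (θ : LatCon L) : Clo x y (col f θ) := by
  intro q p hq h
  rcases h.dir hx hy with h' | h'
  · exact col_clo_aux hx hy R θ hq h h'.1
  · exact col_clo_aux hy hx R.swap θ hq h.swap h'.2

theorem col_conOf [Finite ι] (hx : Function.Injective x) (hy : Function.Injective y)
    (R : Rep x y f) (T : Set ι) (hT : Clo x y T) : col f (conOf hx hy R T hT) = T := by
  ext p
  constructor
  · rintro ⟨u, v, h, h1, h2⟩
    by_contra hp
    exact h2 ((h p hp).1 h1)
  · intro hp
    obtain ⟨c, hc⟩ := R.surj _ (hc_Qd (x := x) (y := y) p)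
    obtain ⟨b, hb⟩ := R.surj _ (hc_NE (x := x) (y := y) p)
    refine ⟨c, b, ?_, ?_, ?_⟩
    · intro s hs
      rw [hc, hb, mem_Qd_iff hx hy]
      constructor
      · rintro (rfl | h)
        · exact absurd hp hs
        · exact h
      · exact Or.inr
    · rw [hc]; exact ⟨le_rfl, le_rfl⟩
    · rw [hb]; exact fun h => lt_irrefl _ h.1

theorem col_le_iff [Finite ι] (hx : Function.Injective x) (hy : Function.Injective y)
    (R : Rep x y f) {θ φ : LatCon L} : θ ≤ φ ↔ col f θ ⊆ col f φ := by
  constructor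
  · rintro h p ⟨u, v, huv, h1⟩
    exact ⟨u, v, h _ _ huv, h1⟩
  · intro h u v huv
    rw [col_spec hx hy R] at huv ⊢
    exact fun p hp => huv p fun h' => hp (h h')

theorem col_sup [Finite ι] (hx : Function.Injective x) (hy : Function.Injective y)
    (R : Rep x y f) (θ φ : LatCon L) : col f (θ ⊔ φ) = col f θ ∪ col f φ := by
  have hU : Clo x y (col f θ ∪ col f φ) := by
    rintro q p (h | h) hs
    · exact Or.inl (col_clo hx hy R θ q p h hs)
    · exact Or.inr (col_clo hx hy R φ q p h hs)
  apply Set.Subset.antisymm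
  · rw [← col_conOf hx hy R _ hU, ← col_le_iff hx hy R]
    refine sup_le ?_ ?_ <;> rw [col_le_iff hx hy R, col_conOf]
    · exact Set.subset_union_left
    · exact Set.subset_union_right
  · exact Set.union_subset ((col_le_iff hx hy R).1 le_sup_left)
      ((col_le_iff hx hy R).1 le_sup_right)

theorem col_bot [Finite ι] (hx : Function.Injective x) (hy : Function.Injective y)
    (R : Rep x y f) : col f (⊥ : LatCon L) = ∅ := by
  have hU : Clo x y (∅ : Set ι) := fun q p h => absurd h (Set.notMem_empty q)
  rw [← Set.subset_empty_iff, ← col_conOf hx hy R _ hU, ← col_le_iff hx hy R]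
  exact bot_le

/-- Reachability by steps. -/
abbrev Reach (x y : ι → ℕ) : ι → ι → Prop := Relation.ReflTransGen (Step x y)

theorem clo_reach (q : ι) : Clo x y {p | Reach x y q p} :=
  fun _ _ h1 h2 => Relation.ReflTransGen.tail h1 h2

theorem Clo.reach {T : Set ι} (hT : Clo x y T) {q p : ι} (hq : q ∈ T) (h : Reach x y q p) :
    p ∈ T := by
  induction h with
  | refl => exact hq
  | tail _ h ih => exact hT _ _ ih h

/-- The join-irreducible congruences are described by the reachability preorder. -/
theorem ji_con [Finite ι] (hx : Function.Injective x) (hy : Function.Injective y)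
    (R : Rep x y f) : ∃ s : ι → {θ : LatCon L // JoinIrred θ}, Function.Surjective s ∧
      ∀ p q, s p ≤ s q ↔ Reach x y q p := by
  have hcol := fun q => col_conOf hx hy R _ (clo_reach (x := x) (y := y) q)
  have hle : ∀ q θ, q ∈ col f θ → conOf hx hy R _ (clo_reach q) ≤ θ := by
    intro q θ hq
    rw [col_le_iff hx hy R, hcol]
    exact fun p hp => (col_clo hx hy R θ).reach hq hp
  have hself : ∀ q, q ∈ col f (conOf hx hy R _ (clo_reach q)) := by
    intro q
    rw [hcol]
    exact Relation.ReflTransGen.refl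
  have hJI : ∀ q, JoinIrred (conOf hx hy R _ (clo_reach (x := x) (y := y) q)) := by
    intro q
    constructor
    · intro h
      have := hself q
      rw [h, col_bot hx hy R] at this
      exact this
    · intro φ ψ h
      have h1 := hself q
      rw [h, col_sup hx hy R] at h1
      rcases h1 with h1 | h1
      · left
        exact le_antisymm (hle _ _ h1) (h ▸ le_sup_left)
      · right
        exact le_antisymm (hle _ _ h1) (h ▸ le_sup_right)
  refine ⟨fun q => ⟨_, hJI q⟩, ?_, ?_⟩
  · rintro ⟨θ, h0, hθ⟩
    have hirr : SupIrred θ := by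
      refine ⟨fun h => h0 h.eq_bot, fun b c h => ?_⟩
      rcases hθ b c h.symm with h | h
      · exact Or.inl h.symm
      · exact Or.inr h.symm
    have hsup : ((col f θ).toFinite.toFinset).sup
        (fun q => conOf hx hy R _ (clo_reach (x := x) (y := y) q)) = θ := by
      apply le_antisymm
      · refine Finset.sup_le fun q hq => hle _ _ ?_
        simpa using hq
      · rw [col_le_iff hx hy R]
        intro q hq
        refine (col_le_iff hx hy R).1 (Finset.le_sup (b := q)
          (f := fun q => conOf hx hy R _ (clo_reach (x := x) (y := y) q)) (by simpa using hq)) ?_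
        exact hself q
    obtain ⟨q, -, hq⟩ := hirr.finset_sup_eq hsup
    exact ⟨q, Subtype.ext hq⟩
  · intro p q
    rw [Subtype.mk_le_mk, col_le_iff hx hy R, hcol, hcol]
    exact ⟨fun h => h Relation.ReflTransGen.refl, fun h r hr => h.trans hr⟩

end rep

end SlimQuad
/-! ### Every slim semimodular lattice is represented by a quadrant system -/

namespace SlimQuad

/-- A finite chain extends to a maximal chain, indexed by natural numbers. -/
theorem exists_chain_seq {L : Type*} [Lattice L] [BoundedOrder L] [Finite L] (C : Set L)
    (hC : IsChain (· ≤ ·) C) :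
    ∃ (n : ℕ) (a : ℕ → L), Monotone a ∧ a 0 = ⊥ ∧ a n = ⊤ ∧ (∀ i < n, a i ⋖ a (i + 1)) ∧
      ∀ c ∈ C, ∃ i ≤ n, a i = c := by
  classical
  obtain ⟨F, hF⟩ := hC.exists_subset_flag
  haveI : Fintype F := Fintype.ofFinite F
  obtain ⟨n, hn⟩ : ∃ n, Fintype.card F = n + 1 :=
    Nat.exists_eq_succ_of_ne_zero (Fintype.card_ne_zero (α := F))
  let e : Fin (n + 1) ≃o F := Fintype.orderIsoFinOfCardEq F hn
  have hmono : Monotone fun i : ℕ => (e ⟨min i n, by omega⟩ : L) := by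
    intro i j hij
    have : e ⟨min i n, by omega⟩ ≤ e ⟨min j n, by omega⟩ := by
      apply e.monotone
      simp only [Fin.mk_le_mk]
      omega
    exact this
  refine ⟨n, fun i => e ⟨min i n, by omega⟩, hmono, ?_, ?_, ?_, ?_⟩
  · have : e ⟨min 0 n, by omega⟩ = ⊥ := by
      rw [← e.map_bot]
      congr 1
    simp only [this]
    rfl
  · have : e ⟨min n n, by omega⟩ = ⊤ := by
      rw [← e.map_top]
      congr 1
      ext
      simp [Fin.top_eq_last]
    simp only [this]
    rfl
  · intro i hi
    constructor
    · have : e ⟨min i n, by omega⟩ < e ⟨min (i + 1) n, by omega⟩ := by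
        apply e.strictMono
        simp only [Fin.mk_lt_mk]
        omega
      exact this
    · intro c h1 h2
      have hcF : c ∈ F := by
        by_contra hcF
        have hins : IsChain (· ≤ ·) (insert c (F : Set L)) := by
          refine F.chain_le.insert fun b hb _ => ?_
          obtain ⟨k, hk⟩ := e.surjective ⟨b, hb⟩
          have hkb : (e k : L) = b := by rw [hk]
          rw [← hkb]
          rcases le_or_gt (k : ℕ) i with hki | hki
          · right
            refine le_trans ?_ h1.le
            have : e k ≤ e ⟨min i n, by omega⟩ := by
              apply e.monotone
              rw [Fin.le_def]
              simp only
              omega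
            exact this
          · left
            refine le_trans h2.le ?_
            have : e ⟨min (i + 1) n, by omega⟩ ≤ e k := by
              apply e.monotone
              rw [Fin.le_def]
              simp only
              omega
            exact this
        have := F.maxChain.2 hins (Set.subset_insert _ _)
        exact hcF (by rw [← SetLike.mem_coe, this]; exact Set.mem_insert _ _)
      obtain ⟨k, hk⟩ := e.surjective ⟨c, hcF⟩
      have h1' : e ⟨min i n, by omega⟩ < e k := by rw [hk]; exact h1
      have h2' : e k < e ⟨min (i + 1) n, by omega⟩ := by rw [hk]; exact h2
      rw [e.lt_iff_lt, Fin.lt_def] at h1' h2'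
      simp only at h1' h2'
      omega
  · intro c hc
    obtain ⟨k, hk⟩ := e.surjective ⟨c, hF hc⟩
    refine ⟨k, by omega, ?_⟩
    have : (⟨min (k : ℕ) n, by omega⟩ : Fin (n + 1)) = k := by
      ext
      simp only
      omega
    simp only [this, hk]

theorem exists_rep {L : Type*} [Lattice L] [OrderBot L] [Finite L] (hslim : Slim L)
    (hsm : Semimodular L) :
    ∃ (n : ℕ) (x y : Fin n → ℕ) (f : L → Set (Fin n)), Function.Injective x ∧
      Function.Injective y ∧ Rep x y f := by
  classical
  obtain ⟨C₁, C₂, hC₁, hC₂, hJ⟩ := hslim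
  haveI : Nonempty L := ⟨⊥⟩
  letI : OrderTop L := by
    haveI := Fintype.ofFinite L
    exact { top := Finset.univ.sup' ⟨⊥, Finset.mem_univ _⟩ id
            le_top := fun a => Finset.le_sup' id (Finset.mem_univ a) }
  letI : BoundedOrder L := {}
  obtain ⟨n, a, ha, ha0, han, hacov, haC⟩ := exists_chain_seq C₁ hC₁
  obtain ⟨m, b, hb, hb0, hbm, hbcov, hbC⟩ := exists_chain_seq C₂ hC₂
  have hmax : ∀ {c : ℕ → L}, Monotone c → ∀ {i j : ℕ}, c (max i j) = c i ⊔ c j := by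
    intro c hc i j
    rcases le_total i j with h | h
    · rw [max_eq_right h, sup_eq_right.2 (hc h)]
    · rw [max_eq_left h, sup_eq_left.2 (hc h)]
  -- every element is of the form `a i ⊔ b j`
  have hform : ∀ u : L, ∃ i ≤ n, ∃ j, u = a i ⊔ b j := by
    intro u
    induction u using WellFoundedLT.induction with
    | _ u ih =>
    by_cases hu : u = ⊥
    · exact ⟨0, by omega, 0, by rw [ha0, hb0, hu, sup_idem]⟩
    by_cases hji : JoinIrred u
    · have : u ∈ C₁ ∪ C₂ := hJ ▸ hji
      rcases this with h | h
      · obtain ⟨i, hi, hi'⟩ := haC u h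
        exact ⟨i, hi, 0, by rw [hb0, hi', sup_bot_eq]⟩
      · obtain ⟨j, hj, hj'⟩ := hbC u h
        exact ⟨0, by omega, j, by rw [ha0, hj', bot_sup_eq]⟩
    · have : ∃ v w, u = v ⊔ w ∧ u ≠ v ∧ u ≠ w := by
        by_contra hcon
        push Not at hcon
        refine hji ⟨hu, fun v w h => ?_⟩
        by_contra hne
        rw [not_or] at hne
        exact hne.2 (hcon v w h hne.1)
      obtain ⟨v, w, h, hv, hw⟩ := this
      obtain ⟨i, hi, j, hij⟩ := ih v (lt_of_le_of_ne (h ▸ le_sup_left) hv.symm)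
      obtain ⟨i', hi', j', hij'⟩ := ih w (lt_of_le_of_ne (h ▸ le_sup_right) hw.symm)
      refine ⟨max i i', by omega, max j j', ?_⟩
      rw [h, hij, hij', hmax ha, hmax hb]
      ac_rfl
  have hex : ∀ k : Fin n, ∃ j, a (k + 1) ≤ a k ⊔ b (j + 1) := by
    intro k
    refine ⟨m, le_trans le_top (le_trans ?_ le_sup_right)⟩
    rw [← hbm]
    exact hb (by omega)
  let x : Fin n → ℕ := fun k => k
  let y : Fin n → ℕ := fun k => Nat.find (hex k)
  let f : L → Set (Fin n) := fun u => {k | ¬ a (k + 1) ≤ a k ⊔ u}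
  have hy : ∀ (k : Fin n) (j : ℕ), ¬ a (k + 1) ≤ a k ⊔ b j ↔ j ≤ y k := by
    intro k j
    constructor
    · intro h
      by_contra hlt
      apply h
      refine (Nat.find_spec (hex k)).trans (sup_le_sup_left (hb ?_) _)
      simp only [y] at hlt
      omega
    · intro h
      cases j with
      | zero =>
        rw [hb0, sup_bot_eq]
        exact (hacov k k.2).1.not_ge
      | succ j => exact Nat.find_min (hex k) (by simp only [y] at h; omega)
  have hf : ∀ i j, f (a i ⊔ b j) = {k | i ≤ x k ∧ j ≤ y k} := by
    intro i j
    ext k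
    change (¬ a (k + 1) ≤ a k ⊔ (a i ⊔ b j)) ↔ i ≤ (k : ℕ) ∧ j ≤ y k
    rcases le_or_gt i k with hik | hik
    · rw [← sup_assoc, sup_eq_left.2 (ha hik), hy]
      exact ⟨fun h => ⟨hik, h⟩, fun h => h.2⟩
    · constructor
      · intro h
        exact absurd ((ha hik).trans (le_sup_of_le_right le_sup_left)) h
      · intro h
        omega
  have hinf : ∀ u v, f (u ⊔ v) = f u ∩ f v := by
    intro u v
    obtain ⟨i, -, j, rfl⟩ := hform u
    obtain ⟨i', -, j', rfl⟩ := hform v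
    have : a i ⊔ b j ⊔ (a i' ⊔ b j') = a (max i i') ⊔ b (max j j') := by
      rw [hmax ha, hmax hb]
      ac_rfl
    rw [this, hf, hf, hf]
    ext k
    simp only [Set.mem_setOf_eq, Set.mem_inter_iff, max_le_iff]
    tauto
  have hanti : ∀ u v : L, u ≤ v → f v ⊆ f u := by
    intro u v h k hk hk'
    exact hk (hk'.trans (sup_le_sup_left h _))
  have hstrict : ∀ v w : L, v ≤ w → f v ⊆ f w → w ≤ v := by
    intro v w hvw hfs
    by_contra hwv
    have hex' : ∃ k, w ≤ v ⊔ a k := ⟨n, by rw [han]; exact le_top.trans le_sup_right⟩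
    have h1 := Nat.find_spec hex'
    have h2 := @Nat.find_min _ _ hex'
    have h3 : Nat.find hex' ≤ n := Nat.find_min' hex' (by rw [han]; exact le_top.trans le_sup_right)
    obtain ⟨k, hk⟩ : ∃ k, Nat.find hex' = k + 1 := by
      apply Nat.exists_eq_succ_of_ne_zero
      intro h0
      rw [h0, ha0, sup_bot_eq] at h1
      exact hwv h1
    have h4 : ¬ w ≤ v ⊔ a k := h2 (by omega)
    rw [hk] at h1 h3
    have hlt : a k ⊔ v < a k ⊔ w := by
      refine lt_of_le_of_ne (sup_le_sup_left hvw _) fun h => h4 ?_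
      rw [sup_comm v, h]
      exact le_sup_right
    have hle : a k ⊔ w ≤ a (k + 1) ⊔ v :=
      sup_le (le_sup_of_le_left (ha (by omega))) (by rwa [sup_comm])
    have hcov : a k ⊔ v ⋖ a (k + 1) ⊔ v := by
      rcases hsm _ _ v (hacov k h3) with h | h
      · exact h
      · exact absurd (hlt.trans_le hle) (by rw [h]; exact lt_irrefl _)
    have heq : a k ⊔ w = a (k + 1) ⊔ v := by
      by_contra hne
      exact hcov.2 hlt (lt_of_le_of_ne hle hne)
    have hkv : (⟨k, h3⟩ : Fin n) ∈ f v := by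
      intro h
      have : a (k + 1) ⊔ v ≤ a k ⊔ v := sup_le h le_sup_right
      exact absurd hcov.1 this.not_gt
    exact hfs hkv (by
      change a (k + 1) ≤ a k ⊔ w
      rw [heq]
      exact le_sup_left)
  have hxinj : Function.Injective x := fun k l h => Fin.ext h
  have hyaux : ∀ k l : Fin n, k < l → y k ≠ y l := by
    intro k l hkl h
    have h1 : ¬ a (k + 1) ≤ a k ⊔ b (y k) := (hy _ _).2 le_rfl
    have h2 : a (k + 1) ≤ a k ⊔ b (y k + 1) := Nat.find_spec (hex k)
    have h3 : ¬ a (l + 1) ≤ a l ⊔ b (y l) := (hy _ _).2 le_rfl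
    have h4 : a (l + 1) ≤ a l ⊔ b (y l + 1) := Nat.find_spec (hex l)
    rw [← h] at h3 h4
    have hjm : y k < m := by
      by_contra hge
      apply h1
      refine le_top.trans (le_trans ?_ le_sup_right)
      rw [← hbm]
      exact hb (not_lt.1 hge)
    have hlt : a k ⊔ b (y k) < a (k + 1) ⊔ b (y k) := by
      refine lt_of_le_of_ne (sup_le_sup_right (ha (by omega)) _) fun h => h1 ?_
      rw [h]
      exact le_sup_left
    have hle : a (k + 1) ⊔ b (y k) ≤ a k ⊔ b (y k + 1) :=
      sup_le h2 (le_sup_of_le_right (hb (by omega)))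
    have heq : a (k + 1) ⊔ b (y k) = a k ⊔ b (y k + 1) := by
      rcases hsm _ _ (a k) (hbcov _ hjm) with h | h
      · rw [sup_comm (b _), sup_comm (b _)] at h
        by_contra hne
        exact h.2 hlt (lt_of_le_of_ne hle hne)
      · rw [sup_comm (b _), sup_comm (b _)] at h
        exact absurd (hlt.trans_le hle) (by rw [h]; exact lt_irrefl _)
    apply h3
    refine h4.trans (sup_le le_sup_left ?_)
    calc b (y k + 1) ≤ a k ⊔ b (y k + 1) := le_sup_right
      _ = a (k + 1) ⊔ b (y k) := heq.symm
      _ ≤ a l ⊔ b (y k) := sup_le_sup_right (ha hkl) _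
  have hyinj : Function.Injective y := by
    intro k l h
    rcases lt_trichotomy k l with h' | h' | h'
    · exact absurd h (hyaux k l h')
    · exact h'
    · exact absurd h.symm (hyaux l k h')
  refine ⟨n, x, y, f, hxinj, hyinj, ⟨?_, ?_, ?_⟩⟩
  · intro u v
    refine ⟨hanti u v, fun h => ?_⟩
    refine le_trans le_sup_left (hstrict v (u ⊔ v) le_sup_right ?_)
    rw [hinf]
    exact Set.subset_inter h le_rfl
  · intro u
    obtain ⟨i, -, j, rfl⟩ := hform u
    rw [hf]
    rintro p ⟨t, ht, h1⟩ ⟨t', ht', h2⟩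
    exact ⟨ht.1.trans h1, ht'.2.trans h2⟩
  · intro A hA
    rcases A.eq_empty_or_nonempty with h | h
    · refine ⟨a n ⊔ b 0, ?_⟩
      rw [hf, h, Set.eq_empty_iff_forall_notMem]
      rintro k ⟨h1, -⟩
      exact absurd k.2 (not_lt.2 h1)
    · obtain ⟨p, hp, hpmin⟩ := Set.exists_min_image A x A.toFinite h
      obtain ⟨q, hq, hqmin⟩ := Set.exists_min_image A y A.toFinite h
      refine ⟨a (x p) ⊔ b (y q), ?_⟩
      rw [hf]
      ext k
      exact ⟨fun hk => hA k ⟨p, hp, hk.1⟩ ⟨q, hq, hk.2⟩, fun hk => ⟨hpmin k hk, hqmin k hk⟩⟩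

/-! ### The lattice of a quadrant system -/

/-- The hull-closed sets, ordered by reverse inclusion. -/
structure QL {ι : Type} (x y : ι → ℕ) where
  s : Set ι
  hc : HC x y s

namespace QL
variable {ι : Type} {x y : ι → ℕ}

theorem ext' {A B : QL x y} (h : A.s = B.s) : A = B := by
  cases A; cases B; cases h; rfl

instance : Lattice (QL x y) where
  le A B := B.s ⊆ A.s
  le_refl A := Set.Subset.refl A.s
  le_trans _ _ _ h1 h2 := Set.Subset.trans h2 h1
  le_antisymm _ _ h1 h2 := ext' (Set.Subset.antisymm h2 h1)
  sup A B := ⟨A.s ∩ B.s, A.hc.inter B.hc⟩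
  inf A B := ⟨hull x y (A.s ∪ B.s), hc_hull _⟩
  le_sup_left _ _ := Set.inter_subset_left
  le_sup_right _ _ := Set.inter_subset_right
  sup_le _ _ _ h1 h2 := Set.subset_inter h1 h2
  inf_le_left _ _ := Set.subset_union_left.trans (subset_hull _)
  inf_le_right _ _ := Set.subset_union_right.trans (subset_hull _)
  le_inf A _ _ h1 h2 := hull_subset A.hc (Set.union_subset h1 h2)

instance : OrderBot (QL x y) where
  bot := ⟨Set.univ, fun _ _ _ => Set.mem_univ _⟩
  bot_le A := Set.subset_univ A.s

theorem le_def {A B : QL x y} : A ≤ B ↔ B.s ⊆ A.s := Iff.rfl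

theorem sup_s (A B : QL x y) : (A ⊔ B).s = A.s ∩ B.s := rfl

instance [Finite ι] : Finite (QL x y) :=
  Finite.of_injective (fun A : QL x y => A.s) fun _ _ h => ext' h

theorem slim : Slim (QL x y) := by
  refine ⟨{A | JoinIrred A ∧ ∀ t ∈ A.s, ∀ s, x t ≤ x s → s ∈ A.s},
    {A | JoinIrred A ∧ ∀ t ∈ A.s, ∀ s, y t ≤ y s → s ∈ A.s}, ?_, ?_, ?_⟩
  · rintro A ⟨-, hA⟩ B ⟨-, hB⟩ -
    by_contra h
    rw [not_or] at h
    obtain ⟨h1, h2⟩ := h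
    obtain ⟨b, hb, hbA⟩ := Set.not_subset.1 h1
    obtain ⟨a, ha, haB⟩ := Set.not_subset.1 h2
    rcases le_total (x a) (x b) with h | h
    · exact hbA (hA a ha b h)
    · exact haB (hB b hb a h)
  · rintro A ⟨-, hA⟩ B ⟨-, hB⟩ -
    by_contra h
    rw [not_or] at h
    obtain ⟨h1, h2⟩ := h
    obtain ⟨b, hb, hbA⟩ := Set.not_subset.1 h1
    obtain ⟨a, ha, haB⟩ := Set.not_subset.1 h2
    rcases le_total (y a) (y b) with h | h
    · exact hbA (hA a ha b h)
    · exact haB (hB b hb a h)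
  · ext A
    constructor
    · intro hA
      let X : QL x y := ⟨{s | ∃ t ∈ A.s, x t ≤ x s}, by
        rintro p ⟨t, ⟨r, hr, h1⟩, h2⟩ -
        exact ⟨r, hr, h1.trans h2⟩⟩
      let Y : QL x y := ⟨{s | ∃ t ∈ A.s, y t ≤ y s}, by
        rintro p - ⟨t, ⟨r, hr, h1⟩, h2⟩
        exact ⟨r, hr, h1.trans h2⟩⟩
      have hXY : A = X ⊔ Y := by
        apply ext'
        ext p
        exact ⟨fun hp => ⟨⟨p, hp, le_rfl⟩, p, hp, le_rfl⟩, fun hp => A.hc p hp.1 hp.2⟩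
      rcases hA.2 X Y hXY with h | h
      · left
        refine ⟨hA, fun t ht s hs => ?_⟩
        rw [h]
        exact ⟨t, ht, hs⟩
      · right
        refine ⟨hA, fun t ht s hs => ?_⟩
        rw [h]
        exact ⟨t, ht, hs⟩
    · rintro (h | h) <;> exact h.1

theorem semimodular [Finite ι] (hx : Function.Injective x) (hy : Function.Injective y) :
    Semimodular (QL x y) := by
  intro A B Z hAB
  have hBA : B.s ⊆ A.s := hAB.1.le
  have hne : B.s ≠ A.s := fun h => hAB.1.ne (ext' h.symm)
  obtain ⟨q, hqA, hqB, hq⟩ := exists_removable hx hy B.hc A.hc hBA hne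
  have hAB' : ∀ s ∈ A.s, s = q ∨ s ∈ B.s := by
    intro s hs
    by_contra hcon
    rw [not_or] at hcon
    let W : QL x y := ⟨A.s \ {q}, hq⟩
    refine hAB.2 (c := W) (lt_of_le_of_ne (fun s hs => hs.1) ?_) (lt_of_le_of_ne ?_ ?_)
    · intro h
      rw [h] at hqA
      exact hqA.2 rfl
    · exact fun s hs => ⟨hBA hs, fun h => hqB (h ▸ hs)⟩
    · intro h
      apply hcon.2
      rw [← h]
      exact ⟨hs, hcon.1⟩
  have hle : A ⊔ Z ≤ B ⊔ Z := sup_le_sup_right hAB.1.le _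
  by_cases heq : A ⊔ Z = B ⊔ Z
  · exact Or.inr heq
  · left
    refine ⟨lt_of_le_of_ne hle heq, fun C h1 h2 => ?_⟩
    by_cases hqC : q ∈ C.s
    · refine h1.not_ge fun s hs => ?_
      rcases hAB' s hs.1 with rfl | h
      · exact hqC
      · exact h2.le (show s ∈ (B ⊔ Z).s from ⟨h, hs.2⟩)
    · refine h2.not_ge fun s hs => ?_
      have hs' : s ∈ (A ⊔ Z).s := h1.le hs
      rcases hAB' s hs'.1 with rfl | h
      · exact absurd hs hqC
      · exact ⟨h, hs'.2⟩

theorem rep : Rep x y (fun A : QL x y => A.s) :=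
  ⟨fun _ _ => Iff.rfl, fun A => A.hc, fun A hA => ⟨⟨A, hA⟩, rfl⟩⟩

end QL

/-- Realizability criterion. -/
theorem realizable {S : Type} [PartialOrder S] [Fintype S] (x y : S → ℕ)
    (hx : Function.Injective x) (hy : Function.Injective y)
    (h : ∀ p q : S, p ≤ q ↔ Reach x y q p) :
    ∃ L : SlimSemimodularLattice, Nonempty (S ≃o {θ : LatCon L.carrier // JoinIrred θ}) := by
  obtain ⟨s, hs, hle⟩ := ji_con hx hy (QL.rep (x := x) (y := y))
  haveI : Fintype (QL x y) := Fintype.ofFinite _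
  refine ⟨⟨QL x y, QL.slim, QL.semimodular hx hy⟩, ⟨?_⟩⟩
  have hiff : ∀ p q, s p ≤ s q ↔ p ≤ q := fun p q => (hle p q).trans (h p q).symm
  have hinj : Function.Injective s := fun p q hpq =>
    le_antisymm ((hiff _ _).1 hpq.le) ((hiff _ _).1 hpq.ge)
  exact ⟨Equiv.ofBijective s ⟨hinj, hs⟩, fun {p q} => hiff p q⟩

end SlimQuad
/-! ### A two-colouring of the maximal join-irreducible congruences -/

namespace SlimQuad

section colouring
variable {ι : Type*} {x y : ι → ℕ}

theorem exists_step_nw [Finite ι] (hx : Function.Injective x) {p : ι} (hp : Mid x y p) :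
    ∃ q, Step x y q p ∧ x q < x p := by
  obtain ⟨a, ha1, ha2⟩ := hp.1
  let T : Set ι := {s | x a ≤ x s ∧ x s < x p ∧ ∃ t ∈ insert a (NE x y p), y t ≤ y s}
  have haT : a ∈ T := ⟨le_rfl, ha1, a, Set.mem_insert _ _, le_rfl⟩
  obtain ⟨s, ⟨h1, h2, t, ht, h3⟩, hmax⟩ := Set.exists_max_image T x T.toFinite ⟨a, haT⟩
  have hNE : ∀ t ∈ insert a (NE x y p), y p < y t := by
    rintro t (rfl | ht)
    · exact ha2
    · exact ht.2
  refine ⟨s, ⟨fun h => by rw [h] at h2; omega, hp, fun h => by have := h.1; omega, ?_⟩, h2⟩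
  rintro r ⟨u, hu, hur⟩ ⟨w, hw, hwr⟩
  have hsr : x s ≤ x r := by
    rcases hu with rfl | hu
    · exact hur
    · have := hu.1
      omega
  have hy' : ∃ t ∈ insert a (NE x y p), y t ≤ y r := by
    rcases hw with rfl | hw
    · exact ⟨t, ht, h3.trans hwr⟩
    · exact ⟨w, Or.inr hw, hwr⟩
  obtain ⟨t', ht', h4⟩ := hy'
  have h5 := hNE t' ht'
  rcases lt_trichotomy (x r) (x p) with h | h | h
  · left
    exact hx (le_antisymm (hmax r ⟨h1.trans hsr, h, t', ht', h4⟩) hsr)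
  · rw [hx h] at h4
    omega
  · exact Or.inr ⟨h, by omega⟩

theorem Step.NE_subset {q p : ι} (h : Step x y q p) : NE x y q ⊆ NE x y p := by
  rintro r ⟨h1, h2⟩
  have := h.2.2.2 r ⟨q, Set.mem_insert _ _, h1.le⟩ ⟨q, Set.mem_insert _ _, h2.le⟩
  rcases this with rfl | h
  · omega
  · exact h

theorem Reach.NE_subset {q p : ι} (h : Reach x y q p) : NE x y q ⊆ NE x y p := by
  induction h with
  | refl => exact Set.Subset.refl _
  | tail _ h ih => exact ih.trans h.NE_subset

theorem same_side (hx : Function.Injective x) (hy : Function.Injective y) {q q' p p' : ι}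
    (h : Step x y q p) (h' : Step x y q' p') (hNE : NE x y p = NE x y p')
    (hq : ¬ Mid x y q) (hq' : ¬ Mid x y q') (hxq : x q < x p) (hxq' : x q' < x p') :
    q = q' := by
  have h1 : Step x y q' p := by
    obtain ⟨-, -, h3, h4⟩ := h'
    refine ⟨?_, h.2.1, hNE ▸ h3, hNE ▸ h4⟩
    rintro rfl
    exact hq' h.2.1
  have hd := h.dir hx hy
  have hd' := h'.dir hx hy
  have hq1 : x q' < x p ∧ y p < y q' := by
    rcases h1.dir hx hy with h2 | h2
    · exact h2
    · exact absurd ⟨⟨p, h2.1, h2.2⟩, p', by omega, by omega⟩ hq'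
  have hq2 : x q < x p ∧ y p < y q := by omega
  rcases lt_trichotomy (x q) (x q') with hlt | heq | hlt
  · rcases le_or_gt (y q) (y q') with hle | hgt
    · rcases h.2.2.2 q' ⟨q, Set.mem_insert _ _, hlt.le⟩ ⟨q, Set.mem_insert _ _, hle⟩ with h3 | h3
      · exact h3.symm
      · exact absurd h3 h1.2.2.1
    · exact absurd ⟨⟨q, hlt, hgt⟩, p, hq1.1, hq1.2⟩ hq'
  · exact hx heq
  · rcases le_or_gt (y q') (y q) with hle | hgt
    · rcases h1.2.2.2 q ⟨q', Set.mem_insert _ _, hlt.le⟩ ⟨q', Set.mem_insert _ _, hle⟩ with h3 | h3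
      · exact h3
      · exact absurd h3 h.2.2.1
    · exact absurd ⟨⟨q', hlt, hgt⟩, p, hq2.1, hq2.2⟩ hq

theorem exists_colour [Finite ι] (hx : Function.Injective x) (hy : Function.Injective y)
    {S : Type*} [PartialOrder S] (s : ι → S) (hs : Function.Surjective s)
    (hle : ∀ p q, s p ≤ s q ↔ Reach x y q p) :
    ∃ col : S → Prop, ∀ v w e : S, (∀ z, v ≤ z → z = v) → (∀ z, w ≤ z → z = w) → v ≠ w →
      e < v → e < w → (∀ z, e ≤ z → z ≤ v → z = e ∨ z = v) →
      (∀ z, e ≤ z → z ≤ w → z = e ∨ z = w) → (col v ↔ ¬ col w) := by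
  have hch : ∀ v : S, ∃ q, s q = v ∧ ∀ q', s q' = v → x q ≤ x q' := by
    intro v
    obtain ⟨q, hq⟩ := hs v
    obtain ⟨r, hr, hmin⟩ := Set.exists_min_image {q | s q = v} x (Set.toFinite _) ⟨q, hq⟩
    exact ⟨r, hr, hmin⟩
  choose q hq hqmin using hch
  have hnm : ∀ v, (∀ z, v ≤ z → z = v) → ¬ Mid x y (q v) := by
    intro v hv hm
    obtain ⟨r, hr, hlt⟩ := exists_step_nw hx hm
    have h1 : s (q v) ≤ s r := (hle _ _).2 (Relation.ReflTransGen.single hr)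
    rw [hq] at h1
    have := hqmin v r (hv _ h1)
    omega
  have hstep : ∀ v e, (∀ z, v ≤ z → z = v) → e < v →
      (∀ z, e ≤ z → z ≤ v → z = e ∨ z = v) → ∃ p, Step x y (q v) p ∧ s p = e := by
    intro v e hv hev hc
    obtain ⟨p, rfl⟩ := hs e
    have hr : Reach x y (q v) p := (hle _ _).1 (by rw [hq]; exact hev.le)
    rcases Relation.ReflTransGen.cases_head hr with h | ⟨c, h1, h2⟩
    · rw [← h, hq] at hev
      exact absurd hev (lt_irrefl _)
    · refine ⟨c, h1, ?_⟩
      have h3 : s p ≤ s c := (hle _ _).2 h2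
      have h4 : s c ≤ v := by
        have := (hle c (q v)).2 (Relation.ReflTransGen.single h1)
        rwa [hq] at this
      rcases hc _ h3 h4 with h | h
      · exact h
      · exfalso
        have h5 : Reach x y c (q v) := (hle _ _).1 (by rw [hq, h])
        rcases Relation.ReflTransGen.cases_tail h5 with h6 | ⟨d, -, h6⟩
        · exact h1.1 h6
        · exact hnm v hv h6.2.1
  refine ⟨fun v => ∃ a, x a < x (q v) ∧ y (q v) < y a, ?_⟩
  intro v w e hv hw hne hev hew hcv hcw
  obtain ⟨p, hp, hpe⟩ := hstep v e hv hev hcv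
  obtain ⟨p', hp', hpe'⟩ := hstep w e hw hew hcw
  have hNE : NE x y p = NE x y p' :=
    Set.Subset.antisymm (Reach.NE_subset ((hle _ _).1 (by rw [hpe, hpe'])))
      (Reach.NE_subset ((hle _ _).1 (by rw [hpe, hpe'])))
  have hqne : q v ≠ q w := fun h => hne (by rw [← hq v, h, hq])
  have hmv := hnm v hv
  have hmw := hnm w hw
  rcases hp.dir hx hy with h1 | h1 <;> rcases hp'.dir hx hy with h2 | h2
  · exact absurd (same_side hx hy hp hp' hNE hmv hmw h1.1 h2.1) hqne
  · constructor
    · intro h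
      exact absurd ⟨h, p, h1.1, h1.2⟩ hmv
    · intro h
      exact absurd ⟨p', h2.1, h2.2⟩ h
  · constructor
    · intro _ h
      exact absurd ⟨h, p', h2.1, h2.2⟩ hmw
    · intro _
      exact ⟨p, h1.1, h1.2⟩
  · exact absurd (same_side hy hx hp.swap hp'.swap ((NE_swap p).trans (hNE.trans (NE_swap p').symm))
      (fun h => hmv h.swap) (fun h => hmw h.swap) h1.2 h2.2) hqne

end colouring

/-- The colouring property of the posets in the class. -/
theorem colour_of_mem {S : Type} [PartialOrder S] (L : SlimSemimodularLattice)
    (g : S ≃o {θ : LatCon L.carrier // JoinIrred θ}) :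
    ∃ col : S → Prop, ∀ v w e : S, (∀ z, v ≤ z → z = v) → (∀ z, w ≤ z → z = w) → v ≠ w →
      e < v → e < w → (∀ z, e ≤ z → z ≤ v → z = e ∨ z = v) →
      (∀ z, e ≤ z → z ≤ w → z = e ∨ z = w) → (col v ↔ ¬ col w) := by
  obtain ⟨n, x, y, f, hx, hy, R⟩ := exists_rep L.slim L.semimodular
  obtain ⟨s, hs, hle⟩ := ji_con hx hy R
  refine exists_colour hx hy (fun i => g.symm (s i)) (g.symm.surjective.comp hs) fun p q => ?_
  rw [← hle]
  exact g.symm.le_iff_le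

end SlimQuad
/-! ### Realizing crowns -/

namespace SlimQuad

section crown
variable {V : Type} (σ : V → V) (idx : V → ℕ) (m : ℕ)

/-- The endpoint of the edge `u` with colour `false`. -/
def ept (c : V → Bool) (u : V) : V := if c u then σ u else u

/-- The coordinate function of the crown. -/
def crd (c : V → Bool) : V × Bool → ℕ
  | (u, true) => if c u then (m + 2) * (m + 2) + idx u else idx u * (m + 2)
  | (u, false) => idx (ept σ c u) * (m + 2) + 1 + idx (ept σ (fun v => !c v) u)

variable {σ idx m} {c : V → Bool}

theorem ept_col (hc : ∀ v, c (σ v) = !c v) (u : V) : c (ept σ c u) = false := by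
  unfold ept
  cases h : c u <;> simp [h, hc]

theorem ept_inj (hσ : ∀ v, σ (σ v) ≠ v) {u v : V} (h1 : ept σ c u = ept σ c v)
    (h2 : ept σ (fun v => !c v) u = ept σ (fun v => !c v) v) : u = v := by
  unfold ept at h1 h2
  cases hu : c u <;> cases hv : c v <;> simp [hu, hv] at h1 h2
  · exact h1
  · exact absurd (by rw [← h1]; exact h2) (hσ v)
  · exact absurd (by rw [h1]; exact h2.symm) (hσ u)
  · exact h2

theorem mul_tri {a b : ℕ} (hb : b < m) (ha : a < m) :
    (a < b ∧ a * (m + 2) + (m + 2) ≤ b * (m + 2)) ∨ a = b ∨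
      (b < a ∧ b * (m + 2) + (m + 2) ≤ a * (m + 2)) := by
  rcases lt_trichotomy a b with h | h | h
  · exact Or.inl ⟨h, by nlinarith⟩
  · exact Or.inr (Or.inl h)
  · exact Or.inr (Or.inr ⟨h, by nlinarith⟩)

theorem mul_big {a : ℕ} (ha : a < m) : a * (m + 2) + (m + 2) ≤ (m + 2) * (m + 2) := by
  nlinarith

theorem crd_tf {u : V} (h : c u = false) : crd σ idx m c (u, true) = idx u * (m + 2) := by
  simp [crd, h]

theorem crd_tt {u : V} (h : c u = true) :
    crd σ idx m c (u, true) = (m + 2) * (m + 2) + idx u := by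
  simp [crd, h]

theorem crd_f {u : V} : crd σ idx m c (u, false) =
    idx (ept σ c u) * (m + 2) + 1 + idx (ept σ (fun v => !c v) u) := rfl

theorem crd_f' {u : V} : crd σ idx m (fun v => !c v) (u, false) =
    idx (ept σ (fun v => !c v) u) * (m + 2) + 1 + idx (ept σ c u) := by
  simp [crd]

theorem crd_tf' {u : V} (h : c u = false) :
    crd σ idx m (fun v => !c v) (u, true) = (m + 2) * (m + 2) + idx u := by
  simp [crd, h]

theorem crd_tt' {u : V} (h : c u = true) :
    crd σ idx m (fun v => !c v) (u, true) = idx u * (m + 2) := by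
  simp [crd, h]

theorem crd_inj (hi : Function.Injective idx) (hm : ∀ v, idx v < m)
    (hσ : ∀ v, σ (σ v) ≠ v) : Function.Injective (crd σ idx m c) := by
  rintro ⟨u, b⟩ ⟨v, b'⟩ h
  have k1 := mul_big (hm u)
  have k2 := mul_big (hm v)
  have k1' := hm u
  have k2' := hm v
  have k3 := mul_big (hm (ept σ c u))
  have k4 := mul_big (hm (ept σ c v))
  have k5 := hm (ept σ (fun v => !c v) u)
  have k6 := hm (ept σ (fun v => !c v) v)
  have k7 := mul_tri (hm u) (hm v)
  have k8 := mul_tri (hm u) (hm (ept σ c v))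
  have k9 := mul_tri (hm v) (hm (ept σ c u))
  have k10 := mul_tri (hm (ept σ c u)) (hm (ept σ c v))
  cases b <;> cases b'
  · rw [crd_f, crd_f] at h
    have h1 : idx (ept σ c u) = idx (ept σ c v) := by omega
    rw [h1] at h
    rw [ept_inj hσ (hi h1) (hi (by omega))]
  · cases hv : c v
    · rw [crd_tf hv, crd_f] at h
      rcases k9 with h9 | h9 | h9
      · omega
      · rw [h9] at h
        omega
      · omega
    · rw [crd_tt hv, crd_f] at h
      omega
  · cases hu : c u
    · rw [crd_tf hu, crd_f] at h
      rcases k8 with h9 | h9 | h9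
      · omega
      · rw [h9] at h
        omega
      · omega
    · rw [crd_tt hu, crd_f] at h
      omega
  · cases hv : c v <;> cases hu : c u <;> simp only [crd_tf, crd_tt, hu, hv] at h
    · rw [hi (show idx u = idx v by omega)]
    · omega
    · omega
    · rw [hi (show idx u = idx v by omega)]

theorem crd_between (hi : Function.Injective idx) (hm : ∀ v, idx v < m)
    (hc : ∀ v, c (σ v) = !c v) {u : V} {r : V × Bool}
    (h1 : crd σ idx m c (ept σ c u, true) < crd σ idx m c r)
    (h2 : crd σ idx m c r < crd σ idx m c (u, false)) :
    crd σ idx m (fun v => !c v) r < crd σ idx m (fun v => !c v) (u, false) := by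
  obtain ⟨v, b⟩ := r
  rw [crd_tf (ept_col hc u)] at h1
  rw [crd_f] at h2
  rw [crd_f']
  have k3 := mul_big (hm (ept σ c u))
  have k5 := hm (ept σ (fun v => !c v) u)
  have k5' := hm (ept σ (fun v => !c v) v)
  have k6 := mul_tri (hm (ept σ c u)) (hm v)
  have k8 := mul_tri (hm (ept σ c u)) (hm (ept σ c v))
  have k9 := mul_tri (hm (ept σ (fun v => !c v) u)) (hm (ept σ (fun v => !c v) v))
  have k10 := hm (ept σ c u)
  have k11 := hm (ept σ c v)
  cases b
  · rw [crd_f] at h1 h2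
    rw [crd_f']
    have h3 : idx (ept σ c v) = idx (ept σ c u) := by omega
    rw [h3] at h1 h2 ⊢
    omega
  · cases hv : c v
    · rw [crd_tf hv] at h1 h2
      rcases k6 with h9 | h9 | h9
      · omega
      · rw [h9] at h1
        omega
      · omega
    · rw [crd_tt hv] at h1 h2
      omega

theorem crd_lt {u : V} (hc : ∀ v, c (σ v) = !c v) :
    crd σ idx m c (ept σ c u, true) < crd σ idx m c (u, false) := by
  rw [crd_tf (ept_col hc u), crd_f]
  omega

theorem crd_lt' (hm : ∀ v, idx v < m) {u : V} (hc : ∀ v, c (σ v) = !c v) :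
    crd σ idx m (fun v => !c v) (u, false) < crd σ idx m (fun v => !c v) (ept σ c u, true) := by
  rw [crd_tf' (ept_col hc u), crd_f']
  have := mul_big (hm (ept σ (fun v => !c v) u))
  have := hm (ept σ c u)
  omega

theorem not_col (hc : ∀ v, c (σ v) = !c v) : ∀ v, (fun v => !c v) (σ v) = !(fun v => !c v) v := by
  intro v
  simp [hc]

theorem crd_top (hm : ∀ v, idx v < m) {u : V} {q : V × Bool} (hu : c u = false)
    (h1 : crd σ idx m c q < crd σ idx m c (u, true))
    (h2 : crd σ idx m (fun v => !c v) (u, true) < crd σ idx m (fun v => !c v) q) : False := by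
  obtain ⟨v, b⟩ := q
  rw [crd_tf hu] at h1
  rw [crd_tf' hu] at h2
  cases b
  · rw [crd_f'] at h2
    have := mul_big (hm (ept σ (fun v => !c v) v))
    have := hm (ept σ c v)
    omega
  · cases hv : c v
    · rw [crd_tf hv] at h1
      rw [crd_tf' hv] at h2
      have := mul_tri (hm u) (hm v)
      omega
    · rw [crd_tt hv] at h1
      have := mul_big (hm u)
      omega

theorem crd_step (hi : Function.Injective idx) (hm : ∀ v, idx v < m)
    (hσ : ∀ v, σ (σ v) ≠ v) (hc : ∀ v, c (σ v) = !c v) (u : V) :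
    Step (crd σ idx m c) (crd σ idx m (fun v => !c v)) (ept σ c u, true) (u, false) := by
  have hA1 := crd_lt (idx := idx) (m := m) (u := u) hc
  have hA2 := crd_lt' hm (u := u) hc
  have hB1 := crd_lt (c := fun v => !c v) (idx := idx) (m := m) (u := u) (not_col hc)
  have hB2 := crd_lt' (c := fun v => !c v) hm (u := u) (not_col hc)
  simp only [Bool.not_not] at hB2
  refine ⟨by simp, ⟨⟨_, hA1, hA2⟩, _, hB2, hB1⟩, fun h => ?_, ?_⟩
  · exact absurd h.1 hA1.not_gt
  · rintro r ⟨t, ht, h1⟩ ⟨t', ht', h2⟩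
    have h3 : crd σ idx m c (ept σ c u, true) ≤ crd σ idx m c r := by
      rcases ht with rfl | ht
      · exact h1
      · exact (hA1.trans (ht.1.trans_le h1)).le
    have h4 : crd σ idx m (fun v => !c v) (u, false) < crd σ idx m (fun v => !c v) r := by
      rcases ht' with rfl | ht'
      · exact hA2.trans_le h2
      · exact ht'.2.trans_le h2
    rcases h3.lt_or_eq with h3 | h3
    · rcases lt_trichotomy (crd σ idx m c r) (crd σ idx m c (u, false)) with h | h | h
      · exact absurd (crd_between hi hm hc h3 h) h4.not_gt
      · rw [crd_inj hi hm hσ h] at h4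
        exact absurd h4 (lt_irrefl _)
      · exact Or.inr ⟨h, h4⟩
    · exact Or.inl (crd_inj hi hm hσ h3.symm)

theorem crd_step_inv_aux (hi : Function.Injective idx) (hm : ∀ v, idx v < m)
    (hσ : ∀ v, σ (σ v) ≠ v) (hc : ∀ v, c (σ v) = !c v) {u : V} {q : V × Bool}
    (h : Step (crd σ idx m c) (crd σ idx m (fun v => !c v)) q (u, false))
    (h1 : crd σ idx m c q < crd σ idx m c (u, false))
    (h2 : crd σ idx m (fun v => !c v) (u, false) < crd σ idx m (fun v => !c v) q) :
    q = (ept σ c u, true) := by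
  have hA1 := crd_lt (idx := idx) (m := m) (u := u) hc
  have hA2 := crd_lt' hm (u := u) hc
  rcases lt_trichotomy (crd σ idx m c q) (crd σ idx m c (ept σ c u, true)) with h3 | h3 | h3
  · have h4 : crd σ idx m (fun v => !c v) q ≤ crd σ idx m (fun v => !c v) (ept σ c u, true) := by
      by_contra hcon
      exact crd_top hm (ept_col hc u) h3 (not_le.1 hcon)
    rcases h.2.2.2 (ept σ c u, true) ⟨q, Set.mem_insert _ _, h3.le⟩
      ⟨q, Set.mem_insert _ _, h4⟩ with h5 | h5
    · exact h5.symm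
    · exact absurd h5.1 hA1.not_gt
  · exact crd_inj hi hm hσ h3
  · exact absurd (crd_between hi hm hc h3 h1) h2.not_gt

theorem crd_step_iff (hi : Function.Injective idx) (hm : ∀ v, idx v < m)
    (hσ : ∀ v, σ (σ v) ≠ v) (hc : ∀ v, c (σ v) = !c v) (q p : V × Bool) :
    Step (crd σ idx m c) (crd σ idx m (fun v => !c v)) q p ↔
      p.2 = false ∧ q.2 = true ∧ (q.1 = p.1 ∨ q.1 = σ p.1) := by
  have hxi : Function.Injective (crd σ idx m c) := crd_inj hi hm hσ
  have hyi : Function.Injective (crd σ idx m (fun v => !c v)) := crd_inj hi hm hσ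
  have hept : ∀ u v : V, (v = u ∨ v = σ u) ↔ v = ept σ c u ∨ v = ept σ (fun v => !c v) u := by
    intro u v
    unfold ept
    cases hu : c u
    · simp [hu]
    · simp only [hu, if_true, Bool.not_true, Bool.false_eq_true, if_false]
      exact or_comm
  obtain ⟨u, b⟩ := p
  constructor
  · intro h
    cases b
    · refine ⟨rfl, ?_⟩
      rw [hept]
      rcases h.dir hxi hyi with h1 | h1
      · have := crd_step_inv_aux hi hm hσ hc h h1.1 h1.2
        simp [this]
      · have h' : Step (crd σ idx m (fun v => !c v))
            (crd σ idx m (fun v => !(fun v => !c v) v)) q (u, false) := by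
          simpa using h.swap
        have := crd_step_inv_aux (c := fun v => !c v) hi hm hσ (not_col hc) h' h1.2 (by simpa using h1.1)
        simp [this]
    · exfalso
      obtain ⟨⟨a, h1, h2⟩, b, h3, h4⟩ := h.2.1
      cases hu : c u
      · exact crd_top hm hu h1 h2
      · exact crd_top (c := fun v => !c v) hm (by simp [hu]) h4 (by simpa using h3)
  · rintro ⟨h1, h2, h3⟩
    obtain ⟨v, b'⟩ := q
    simp only at h1 h2 h3
    subst h1 h2
    rw [hept] at h3
    rcases h3 with rfl | rfl
    · exact crd_step hi hm hσ hc u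
    · have := (crd_step (c := fun v => !c v) hi hm hσ (not_col hc) u).swap
      simpa using this

theorem crd_reach_iff (hi : Function.Injective idx) (hm : ∀ v, idx v < m)
    (hσ : ∀ v, σ (σ v) ≠ v) (hc : ∀ v, c (σ v) = !c v) (q p : V × Bool) :
    Reach (crd σ idx m c) (crd σ idx m (fun v => !c v)) q p ↔
      p = q ∨ (p.2 = false ∧ q.2 = true ∧ (q.1 = p.1 ∨ q.1 = σ p.1)) := by
  constructor
  · intro h
    induction h with
    | refl => exact Or.inl rfl
    | tail _ h ih =>
      rw [crd_step_iff hi hm hσ hc] at h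
      rcases ih with rfl | ih
      · exact Or.inr h
      · exact absurd (h.2.1.symm.trans ih.1) (by simp)
  · rintro (rfl | h)
    · exact Relation.ReflTransGen.refl
    · exact Relation.ReflTransGen.single ((crd_step_iff hi hm hσ hc _ _).2 h)

end crown

end SlimQuad
/-! ### Twisted double crowns -/

namespace SlimQuad

/-- The successor on the (twisted) double cycle of length `2 * n + 3`. -/
def sg (ε : Bool) (n : ℕ) (v : ZMod (2 * n + 3) × Bool) : ZMod (2 * n + 3) × Bool :=
  (v.1 + 1, xor v.2 (ε && decide (v.1 = -1)))

/-- The crown of the (twisted) double cycle. -/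
def Tw (_ : Bool) (n : ℕ) : Type := (ZMod (2 * n + 3) × Bool) × Bool

instance (ε : Bool) (n : ℕ) : Fintype (Tw ε n) :=
  inferInstanceAs (Fintype ((ZMod (2 * n + 3) × Bool) × Bool))

instance (ε : Bool) (n : ℕ) : Nonempty (Tw ε n) :=
  inferInstanceAs (Nonempty ((ZMod (2 * n + 3) × Bool) × Bool))

instance (ε : Bool) (n : ℕ) : PartialOrder (Tw ε n) where
  le p q := p = q ∨ (p.2 = false ∧ q.2 = true ∧ (q.1 = p.1 ∨ q.1 = sg ε n p.1))
  le_refl _ := Or.inl rfl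
  le_trans p q r h1 h2 := by
    rcases h1 with rfl | h1
    · exact h2
    · rcases h2 with rfl | h2
      · exact Or.inr h1
      · exact absurd (h1.2.1.symm.trans h2.1) (by simp)
  le_antisymm p q h1 h2 := by
    rcases h1 with rfl | h1
    · rfl
    · rcases h2 with rfl | h2
      · rfl
      · exact absurd (h1.2.1.symm.trans h2.1) (by simp)

theorem Tw.le_def {ε : Bool} {n : ℕ} {p q : Tw ε n} :
    p ≤ q ↔ p = q ∨ (p.2 = false ∧ q.2 = true ∧ (q.1 = p.1 ∨ q.1 = sg ε n p.1)) := Iff.rfl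

theorem neg_one_val (n : ℕ) : (-1 : ZMod (2 * n + 3)).val = 2 * n + 2 :=
  ZMod.val_neg_one (2 * n + 2)

theorem Tw.mem (n : ℕ) : ∃ L : SlimSemimodularLattice,
    Nonempty (Tw true n ≃o {θ : LatCon L.carrier // JoinIrred θ}) := by
  let c : ZMod (2 * n + 3) × Bool → Bool := fun v => xor (decide (v.1.val % 2 = 1)) v.2
  let idx : ZMod (2 * n + 3) × Bool → ℕ := fun v => 2 * v.1.val + v.2.toNat
  have hi : Function.Injective idx := by
    rintro ⟨i, s⟩ ⟨j, t⟩ h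
    simp only [idx] at h
    have h1 : i.val = j.val := by
      cases s <;> cases t <;> simp at h <;> omega
    have h2 : s = t := by
      cases s <;> cases t <;> simp at h ⊢ <;> omega
    rw [ZMod.val_injective _ h1, h2]
  have hm : ∀ v, idx v < 4 * n + 6 := by
    rintro ⟨i, s⟩
    have := ZMod.val_lt i
    simp only [idx]
    cases s <;> simp <;> omega
  have hc : ∀ v, c (sg true n v) = !c v := by
    rintro ⟨i, s⟩
    simp only [c, sg]
    by_cases h : i = -1
    · subst h
      have := neg_one_val n
      have h2 : (2 * n + 2) % 2 = 0 := by omega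
      simp [this, h2]
    · have h1 : (i + 1).val = i.val + 1 := by
        have h2 := ZMod.val_lt i
        have h3 : i.val ≠ 2 * n + 2 := fun h' => h (ZMod.val_injective _ (by rw [h', neg_one_val]))
        have : Fact (1 < 2 * n + 3) := ⟨by omega⟩
        have h4 := ZMod.val_one (2 * n + 3)
        rw [ZMod.val_add_of_lt (by omega), h4]
      rw [h1]
      rcases Nat.mod_two_eq_zero_or_one i.val with h2 | h2
      · have h3 : (i.val + 1) % 2 = 1 := by omega
        simp [h, h2, h3]
      · have h3 : (i.val + 1) % 2 = 0 := by omega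
        simp [h, h2, h3]
  have hσ : ∀ v, sg true n (sg true n v) ≠ v := by
    intro v h
    have h1 := congrArg Prod.fst h
    simp only [sg] at h1
    have h2 : ((2 : ℕ) : ZMod (2 * n + 3)) = 0 := by
      have : v.1 + ((2 : ℕ) : ZMod (2 * n + 3)) = v.1 + 0 := by
        rw [add_zero]
        nth_rewrite 2 [← h1]
        push_cast
        ring
      exact add_left_cancel this
    rw [ZMod.natCast_eq_zero_iff] at h2
    have := Nat.le_of_dvd (by omega) h2
    omega
  exact realizable (S := Tw true n) (crd (sg true n) idx (4 * n + 6) c)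
    (crd (sg true n) idx (4 * n + 6) (fun v => !c v)) (crd_inj hi hm hσ) (crd_inj hi hm hσ)
    fun p q => (crd_reach_iff hi hm hσ hc q p).symm

theorem Tw.not_mem (n : ℕ) (L : SlimSemimodularLattice)
    (g : Tw false n ≃o {θ : LatCon L.carrier // JoinIrred θ}) : False := by
  obtain ⟨col, hcol⟩ := colour_of_mem L g
  let v : ZMod (2 * n + 3) → Tw false n := fun i => ((i, false), true)
  let e : ZMod (2 * n + 3) → Tw false n := fun i => ((i, false), false)
  have hmax : ∀ i z, v i ≤ z → z = v i := by
    intro i z h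
    rcases h with h | h
    · exact h.symm
    · exact absurd h.1 (by simp [v])
  have hsg : ∀ i, sg false n (i, false) = (i + 1, false) := by
    intro i
    simp [sg]
  have hev : ∀ i j, j = i ∨ j = i + 1 → e i < v j := by
    intro i j h
    refine lt_of_le_of_ne (Or.inr ⟨rfl, rfl, ?_⟩) ?_
    · change (j, false) = (i, false) ∨ (j, false) = sg false n (i, false)
      rw [hsg]
      rcases h with rfl | rfl <;> simp
    · intro h
      have := congrArg Prod.snd h
      simp [e, v] at this
  have hcov : ∀ i j z, e i ≤ z → z ≤ v j → z = e i ∨ z = v j := by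
    intro i j z h1 h2
    rcases h1 with h1 | h1
    · exact Or.inl h1.symm
    · rcases h2 with h2 | h2
      · exact Or.inr h2
      · exact absurd (h1.2.1.symm.trans h2.1) (by simp)
  have hne : ∀ i, v i ≠ v (i + 1) := by
    intro i h
    have h1 : i = i + 1 := congrArg (fun p : Tw false n => p.1.1) h
    have h2 : (1 : ZMod (2 * n + 3)) = 0 := by
      have : i + 1 = i + 0 := by rw [add_zero]; exact h1.symm
      exact add_left_cancel this
    have : Fact (1 < 2 * n + 3) := ⟨by omega⟩
    exact one_ne_zero h2
  have hstep : ∀ i, (col (v i) ↔ ¬ col (v (i + 1))) := fun i =>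
    hcol (v i) (v (i + 1)) (e i) (hmax i) (hmax _) (hne i) (hev i i (Or.inl rfl))
      (hev i _ (Or.inr rfl)) (hcov i i) (hcov i _)
  have hind : ∀ k : ℕ, (col (v (k : ZMod (2 * n + 3))) ↔ (Even k ↔ col (v 0))) := by
    intro k
    induction k with
    | zero => simp
    | succ k ih =>
      have h1 := hstep (k : ZMod (2 * n + 3))
      push_cast
      rw [Nat.even_add_one]
      tauto
  have h := hind (2 * n + 3)
  rw [ZMod.natCast_self] at h
  have hodd : ¬ Even (2 * n + 3) := by
    rw [Nat.not_even_iff_odd]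
    exact ⟨n + 1, by ring⟩
  tauto

end SlimQuad
/-! ### The two ultraproducts are isomorphic -/

namespace SlimQuad

open Filter

noncomputable section

/-- The ultrafilter. -/
abbrev uf : Ultrafilter ℕ := hyperfilter ℕ

/-- The position of `m` is a standard natural number. -/
def std {ε : Bool} (m : ∀ n, Tw ε n) : Prop :=
  ∃ k : ℕ, ∀ᶠ n in (uf : Filter ℕ), (m n).1.1 = (k : ZMod (2 * n + 3))

open Classical in
/-- Exchange the two sheets at standard positions. -/
def flp (ε ε' : Bool) (m : ∀ n, Tw ε n) : ∀ n, Tw ε' n := fun n =>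
  if std m then (((m n).1.1, !(m n).1.2), (m n).2) else m n

theorem flp_pos {ε ε' : Bool} {m : ∀ n, Tw ε n} (h : std m) (n : ℕ) :
    flp ε ε' m n = (((m n).1.1, !(m n).1.2), (m n).2) := if_pos h

theorem flp_neg {ε ε' : Bool} {m : ∀ n, Tw ε n} (h : ¬ std m) (n : ℕ) :
    flp ε ε' m n = m n := if_neg h

theorem flp_fst (ε ε' : Bool) (m : ∀ n, Tw ε n) (n : ℕ) :
    (flp ε ε' m n).1.1 = (m n).1.1 := by
  by_cases h : std m
  · rw [flp_pos h]
  · rw [flp_neg h]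

theorem flp_snd (ε ε' : Bool) (m : ∀ n, Tw ε n) (n : ℕ) :
    (flp ε ε' m n).2 = (m n).2 := by
  by_cases h : std m
  · rw [flp_pos h]
  · rw [flp_neg h]

theorem std_flp {ε ε' : Bool} {m : ∀ n, Tw ε n} : std (flp ε ε' m) ↔ std m := by
  unfold std
  simp only [flp_fst]

theorem flp_flp (ε ε' : Bool) (m : ∀ n, Tw ε n) : flp ε' ε (flp ε ε' m) = m := by
  funext n
  by_cases h : std m
  · rw [flp_pos (std_flp.2 h), flp_pos h]
    simp only [Bool.not_not]
    rfl
  · rw [flp_neg (fun h' => h (std_flp.1 h')), flp_neg h]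

theorem std_congr {ε ε' : Bool} {m : ∀ n, Tw ε n} {m' : ∀ n, Tw ε' n}
    (h : ∀ᶠ n in (uf : Filter ℕ), (m n).1.1 = (m' n).1.1) : std m → std m' := by
  rintro ⟨k, hk⟩
  exact ⟨k, (h.and hk).mono fun n hn => hn.1.symm.trans hn.2⟩

theorem std_congr_iff {ε ε' : Bool} {m : ∀ n, Tw ε n} {m' : ∀ n, Tw ε' n}
    (h : ∀ᶠ n in (uf : Filter ℕ), (m n).1.1 = (m' n).1.1) : std m ↔ std m' :=
  ⟨std_congr h, std_congr (h.mono fun _ => Eq.symm)⟩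

theorem flp_congr {ε : Bool} (ε' : Bool) {m m' : ∀ n, Tw ε n}
    (h : ∀ᶠ n in (uf : Filter ℕ), m n = m' n) :
    ∀ᶠ n in (uf : Filter ℕ), flp ε ε' m n = flp ε ε' m' n := by
  have hs : std m ↔ std m' := std_congr_iff (h.mono fun n hn => by rw [hn])
  refine h.mono fun n hn => ?_
  by_cases h' : std m
  · rw [flp_pos h', flp_pos (hs.1 h'), hn]
  · rw [flp_neg h', flp_neg (fun h => h' (hs.2 h)), hn]

theorem not_std_of_neg_one {ε : Bool} {m : ∀ n, Tw ε n}
    (h : ∀ᶠ n in (uf : Filter ℕ), (m n).1.1 = -1) : ¬ std m := by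
  rintro ⟨k, hk⟩
  have h3 : ∀ᶠ n in (uf : Filter ℕ), k < n :=
    Nat.hyperfilter_le_atTop (eventually_gt_atTop k)
  obtain ⟨n, h1, h2, h3⟩ := (h.and (hk.and h3)).exists
  rw [h1] at h2
  have h4 : ((k + 1 : ℕ) : ZMod (2 * n + 3)) = 0 := by
    push_cast
    rw [← h2]
    ring
  rw [ZMod.natCast_eq_zero_iff] at h4
  have := Nat.le_of_dvd (by omega) h4
  omega

theorem flp_le {ε ε' : Bool} (hε : ε' = !ε) {m m' : ∀ n, Tw ε n}
    (h : ∀ᶠ n in (uf : Filter ℕ), m n ≤ m' n) :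
    ∀ᶠ n in (uf : Filter ℕ), flp ε ε' m n ≤ flp ε ε' m' n := by
  simp only [Tw.le_def] at h
  rw [Ultrafilter.eventually_or] at h
  rcases h with h | h
  · exact (flp_congr ε' h).mono fun n hn => Or.inl hn
  have hsnd : ∀ᶠ n in (uf : Filter ℕ), (m n).2 = false ∧ (m' n).2 = true :=
    h.mono fun n hn => ⟨hn.1, hn.2.1⟩
  have h' : ∀ᶠ n in (uf : Filter ℕ), (m' n).1 = (m n).1 ∨ (m' n).1 = sg ε n (m n).1 :=
    h.mono fun n hn => hn.2.2
  suffices hs : ∀ᶠ n in (uf : Filter ℕ), (flp ε ε' m' n).1 = (flp ε ε' m n).1 ∨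
      (flp ε ε' m' n).1 = sg ε' n (flp ε ε' m n).1 by
    refine (hs.and hsnd).mono fun n hn => Or.inr ⟨?_, ?_, hn.1⟩
    · rw [flp_snd]
      exact hn.2.1
    · rw [flp_snd]
      exact hn.2.2
  rw [Ultrafilter.eventually_or] at h' ⊢
  rcases h' with h' | h'
  · left
    have hs : std m' ↔ std m := std_congr_iff (h'.mono fun n hn => by rw [hn])
    refine h'.mono fun n hn => ?_
    by_cases hm : std m
    · rw [flp_pos hm, flp_pos (hs.2 hm), hn]
    · rw [flp_neg hm, flp_neg (fun h => hm (hs.1 h)), hn]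
  right
  rcases Ultrafilter.em uf (fun n => (m n).1.1 = -1) with h1 | h1
  · have hm := not_std_of_neg_one h1
    have hm' : std m' := ⟨0, (h'.and h1).mono fun n hn => by
      rw [hn.1, sg, hn.2]
      simp⟩
    refine (h'.and h1).mono fun n hn => ?_
    rw [flp_neg hm, flp_pos hm', hn.1]
    simp only [sg, hn.2, hε]
    cases ε <;> cases (m n).1.2 <;> simp
  · have hs : std m ↔ std m' := by
      constructor
      · rintro ⟨k, hk⟩
        refine ⟨k + 1, (h'.and hk).mono fun n hn => ?_⟩
        rw [hn.1, sg, hn.2]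
        push_cast
        rfl
      · rintro ⟨k, hk⟩
        cases k with
        | zero =>
          exfalso
          obtain ⟨n, h2, h3, h4⟩ := (h1.and (h'.and hk)).exists
          apply h2
          rw [h3, sg] at h4
          simp only [Nat.cast_zero] at h4
          exact eq_neg_of_add_eq_zero_left h4
        | succ k =>
          refine ⟨k, (h'.and hk).mono fun n hn => ?_⟩
          have h4 := hn.2
          rw [hn.1, sg] at h4
          push_cast at h4
          exact add_right_cancel h4
    refine (h'.and h1).mono fun n hn => ?_
    have hn2 : (m n).1.1 ≠ -1 := hn.2
    by_cases hm : std m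
    · rw [flp_pos hm, flp_pos (hs.1 hm), hn.1]
      simp [sg, hn2]
    · rw [flp_neg hm, flp_neg (fun h => hm (hs.2 h)), hn.1]
      simp [sg, hn2]

instance (ε : Bool) (n : ℕ) : Language.order.Structure (Tw ε n) := Language.orderStructure _

/-- The ultraproduct of the crowns. -/
abbrev UP (ε : Bool) : Type := (uf : Filter ℕ).Product (Tw ε)

/-- The map between the ultraproducts. -/
def upMap (ε ε' : Bool) : UP ε → UP ε' :=
  Quotient.map (flp ε ε') fun _ _ h => flp_congr ε' h

theorem upMap_upMap (ε ε' : Bool) (p : UP ε) : upMap ε' ε (upMap ε ε' p) = p := by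
  induction p using Quotient.inductionOn with
  | _ m =>
    change (Quotient.mk _ (flp ε' ε (flp ε ε' m)) : UP ε) = _
    rw [flp_flp]

theorem up_rel {ε : Bool} {k : ℕ} (r : Language.order.Relations k) (v : Fin k → ∀ n, Tw ε n) :
    Language.Structure.RelMap r (fun i => (Quotient.mk _ (v i) : UP ε)) ↔
      ∀ᶠ n in (uf : Filter ℕ), Language.Structure.RelMap r (fun i => v i n) :=
  Language.relMap_quotient_mk' _ r v

theorem upMap_rel {ε ε' : Bool} (hε : ε' = !ε) {k : ℕ} (r : Language.order.Relations k)
    (v : Fin k → UP ε) (h : Language.Structure.RelMap r v) :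
    Language.Structure.RelMap r (upMap ε ε' ∘ v) := by
  obtain ⟨w, hw⟩ : ∃ w : Fin k → ∀ n, Tw ε n, v = fun i => (Quotient.mk _ (w i) : UP ε) := by
    choose w hw using fun i => Quotient.exists_rep (v i)
    exact ⟨w, funext fun i => (hw i).symm⟩
  subst hw
  have h1 := (up_rel r w).1 h
  refine (up_rel r (fun i => flp ε ε' (w i))).2 ?_
  cases r
  exact flp_le hε h1

/-- The isomorphism of the ultraproducts. -/
def upEquiv : Language.order.Equiv (UP true) (UP false) where
  toFun := upMap true false
  invFun := upMap false true
  left_inv := upMap_upMap _ _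
  right_inv := upMap_upMap _ _
  map_fun' f := isEmptyElim f
  map_rel' r v := by
    refine ⟨fun h => ?_, upMap_rel rfl r v⟩
    have := upMap_rel (ε := false) (ε' := true) rfl r _ h
    rwa [← Function.comp_assoc, show upMap false true ∘ upMap true false = id from
      funext fun p => upMap_upMap _ _ p, Function.id_comp] at this

end

end SlimQuad
/-- There is no first-order sentence in the language with a single binary relation symbol
`≤` that holds in a finite partially ordered set exactly when this poset is isomorphic to
the poset of join-irreducible congruences of some slim semimodular lattice: these posets
are not finitely axiomatizable modulo finiteness. -/
theorem posets_of_joinIrred_congruences_not_finitely_axiomatizable :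
    ¬∃ φ : Language.order.Sentence,
      ∀ (S : Type) [PartialOrder S] [Fintype S],
        (@FirstOrder.Language.Sentence.Realize Language.order S
            (Language.orderStructure S) φ ↔
          ∃ L : SlimSemimodularLattice,
            Nonempty (S ≃o {θ : LatCon L.carrier // JoinIrred θ})) := by
  rintro ⟨φ, hφ⟩
  have h1 : ∀ n, (SlimQuad.Tw true n) ⊨ φ := fun n =>
    (hφ (SlimQuad.Tw true n)).2 (SlimQuad.Tw.mem n)
  have h2 : ∀ n, ¬ (SlimQuad.Tw false n) ⊨ φ := by
    intro n h
    obtain ⟨L, ⟨g⟩⟩ := (hφ (SlimQuad.Tw false n)).1 h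
    exact SlimQuad.Tw.not_mem n L g
  have h3 : SlimQuad.UP true ⊨ φ :=
    (Language.Ultraproduct.sentence_realize φ).2 (Filter.Eventually.of_forall h1)
  have h4 : SlimQuad.UP false ⊨ φ :=
    (Language.StrongHomClass.realize_sentence SlimQuad.upEquiv φ).1 h3
  obtain ⟨n, hn⟩ := ((Language.Ultraproduct.sentence_realize φ).1 h4).exists
  exact h2 n hn
end

section
/- The congruence lattice Con L of any slim semimodular lattice L satisfies the Two-cover Property, that is, every join-irreducible congruence of L has at most two covers in the poset of join-irreducible congruences of L. -/
section SlimProof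

/-- Coordinates: an order embedding into `ℕ × ℕ` preserving binary meets. -/
structure Coord (L : Type*) [Lattice L] where
  α : L → ℕ
  β : L → ℕ
  le_iff : ∀ x y, x ≤ y ↔ α x ≤ α y ∧ β x ≤ β y
  infα : ∀ x y, α (x ⊓ y) = min (α x) (α y)
  infβ : ∀ x y, β (x ⊓ y) = min (β x) (β y)

/-- `z` is a lower cover of `B` strictly between the lower covers `x` and `y`. -/
def LBtw {L : Type*} [Lattice L] (x y z B : L) : Prop :=
  x ⋖ B ∧ y ⋖ B ∧ z ⋖ B ∧ x ≠ y ∧ z ≠ x ∧ z ≠ y ∧ x ⊓ y ≤ z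

/-- internal lower cover -/
def Internal {L : Type*} [Lattice L] (z B : L) : Prop := ∃ x y, LBtw x y z B

/-- `m` is the label of the prime interval `[A, B]`. -/
def Lab {L : Type*} [Lattice L] (m A B : L) : Prop := InfIrred m ∧ A ≤ m ∧ ¬ B ≤ m

/-- the congruence `ψ` collapses `m` -/
def Coll {L : Type*} [Lattice L] (ψ : LatCon L) (m : L) : Prop := ∃ u, m < u ∧ ψ.r m u

/-- least congruence collapsing `m` -/
def thetaC {L : Type*} [Lattice L] (m : L) : LatCon L := sInf {ψ | Coll ψ m}

/-- closed sets of labels -/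
def Clo {L : Type*} [Lattice L] (S : Set L) : Prop :=
  ∀ e x y z B, e ∈ S → LBtw x y z B → Lab e x B → z ∈ S

/-- the relation of a set of labels -/
def LRel {L : Type*} [Lattice L] (S : Set L) (a b : L) : Prop :=
  ∀ m, InfIrred m → m ∉ S → (a ≤ m ↔ b ≤ m)

variable {L : Type*} [Lattice L]

theorem cov_not_le {x y B : L} (hx : x ⋖ B) (hy : y ⋖ B) (h : x ≠ y) : ¬ x ≤ y := fun hle =>
  hx.2 (lt_of_le_of_ne hle h) hy.1

theorem LBtw.symm {x y z B : L} (h : LBtw x y z B) : LBtw y x z B := by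
  obtain ⟨h1, h2, h3, h4, h5, h6, h7⟩ := h
  exact ⟨h2, h1, h3, h4.symm, h6, h5, by rwa [inf_comm]⟩

theorem cov_coord (K : Coord L) {x y B : L} (hx : x ⋖ B) (hy : y ⋖ B) (h : x ≠ y) :
    (K.α y < K.α x ∧ K.β x < K.β y) ∨ (K.α x < K.α y ∧ K.β y < K.β x) := by
  have h1 := cov_not_le hx hy h
  have h2 := cov_not_le hy hx h.symm
  rw [K.le_iff] at h1 h2
  omega

theorem btw_coord (K : Coord L) {x y z B : L} (h : LBtw x y z B) :
    (K.α y < K.α z ∧ K.α z < K.α x ∧ K.β x < K.β z ∧ K.β z < K.β y) ∨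
    (K.α x < K.α z ∧ K.α z < K.α y ∧ K.β y < K.β z ∧ K.β z < K.β x) := by
  obtain ⟨h1, h2, h3, h4, h5, h6, h7⟩ := h
  have a := cov_coord K h1 h2 h4
  have b := cov_coord K h3 h1 h5
  have c := cov_coord K h3 h2 h6
  rw [K.le_iff, K.infα, K.infβ] at h7
  omega

theorem btw_of_coord (K : Coord L) {x y z B : L} (h1 : x ⋖ B) (h2 : y ⋖ B) (h3 : z ⋖ B)
    (h : K.α y < K.α z ∧ K.α z < K.α x) : LBtw x y z B := by
  have h4 : x ≠ y := by rintro rfl; omega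
  have h5 : z ≠ x := by rintro rfl; omega
  have h6 : z ≠ y := by rintro rfl; omega
  have a := cov_coord K h1 h2 h4
  have b := cov_coord K h3 h1 h5
  have c := cov_coord K h3 h2 h6
  refine ⟨h1, h2, h3, h4, h5, h6, ?_⟩
  rw [K.le_iff, K.infα, K.infβ]
  omega

theorem btw_inf_ne (K : Coord L) {x y z B : L} (h : LBtw x y z B) : x ⊓ y < x ⊓ z := by
  have c := btw_coord K h
  refine lt_of_le_of_ne (le_inf inf_le_left h.2.2.2.2.2.2) fun he => ?_
  have ha := congrArg K.α he
  have hb := congrArg K.β he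
  rw [K.infα, K.infα] at ha
  rw [K.infβ, K.infβ] at hb
  omega

theorem btw_eq (K : Coord L) {x y z B u : L} (h : LBtw x y z B) (hu : z ≤ u) (hB : ¬ B ≤ u) :
    u = z := by
  have c := btw_coord K h
  have hz := h.2.2.1
  have hx := h.1.le
  have hy := h.2.1.le
  have e : B ⊓ u = z := by
    rcases hz.eq_or_eq (le_inf hz.le hu) inf_le_left with h | h
    · exact h
    · exact absurd (inf_eq_left.1 h) hB
  have ha := congrArg K.α e
  have hb := congrArg K.β e
  rw [K.infα] at ha
  rw [K.infβ] at hb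
  rw [K.le_iff] at hx hy
  refine le_antisymm ?_ hu
  rw [K.le_iff]
  omega

theorem three_middle (K : Coord L) {x y z B : L} (h1 : x ⋖ B) (h2 : y ⋖ B) (h3 : z ⋖ B)
    (hxy : x ≠ y) (hxz : x ≠ z) (hyz : y ≠ z) : Internal x B ∨ Internal y B ∨ Internal z B := by
  have a := cov_coord K h1 h2 hxy
  have b := cov_coord K h1 h3 hxz
  have c := cov_coord K h2 h3 hyz
  by_cases p : K.α x < K.α y <;> by_cases q : K.α y < K.α z <;> by_cases r : K.α x < K.α z
  · exact Or.inr (Or.inl ⟨z, x, btw_of_coord K h3 h1 h2 ⟨p, q⟩⟩)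
  · omega
  · exact Or.inr (Or.inr ⟨y, x, btw_of_coord K h2 h1 h3 ⟨r, by omega⟩⟩)
  · exact Or.inl ⟨y, z, btw_of_coord K h2 h3 h1 ⟨by omega, by omega⟩⟩
  · exact Or.inl ⟨z, y, btw_of_coord K h3 h2 h1 ⟨by omega, by omega⟩⟩
  · exact Or.inr (Or.inr ⟨x, y, btw_of_coord K h1 h2 h3 ⟨by omega, by omega⟩⟩)
  · omega
  · exact Or.inr (Or.inl ⟨x, z, btw_of_coord K h1 h3 h2 ⟨by omega, by omega⟩⟩)

theorem internal_btw (K : Coord L) {x z B : L} (hx : Internal x B) (hz : z ⋖ B) (hne : z ≠ x) :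
    ∃ y, LBtw z y x B := by
  obtain ⟨p, q, h⟩ := hx
  have c := btw_coord K h
  have d := cov_coord K hz h.2.2.1 hne
  rcases lt_or_gt_of_ne (show K.α z ≠ K.α x by omega) with hlt | hlt
  · rcases c with c | c
    · exact ⟨p, (btw_of_coord K h.1 hz h.2.2.1 ⟨hlt, by omega⟩).symm⟩
    · exact ⟨q, (btw_of_coord K h.2.1 hz h.2.2.1 ⟨hlt, by omega⟩).symm⟩
  · rcases c with c | c
    · exact ⟨q, (btw_of_coord K hz h.2.1 h.2.2.1 ⟨by omega, hlt⟩)⟩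
    · exact ⟨p, (btw_of_coord K hz h.1 h.2.2.1 ⟨by omega, hlt⟩)⟩

theorem exists_lab [Finite L] {A B : L} (h : ¬ B ≤ A) : ∃ m, Lab m A B := by
  obtain ⟨m, hm⟩ := (Set.toFinite {u : L | A ≤ u ∧ ¬ B ≤ u}).exists_maximal ⟨A, le_refl A, h⟩
  have key : ∀ u, m < u → B ≤ u := by
    intro u hu
    by_contra hB
    exact hu.not_ge (hm.2 ⟨hm.1.1.trans hu.le, hB⟩ hu.le)
  refine ⟨m, ⟨?_, ?_⟩, hm.1⟩
  · intro hmax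
    exact hm.1.2 (le_sup_right.trans (hmax (le_sup_left : m ≤ m ⊔ B)))
  · intro b c hbc
    by_contra hcon
    push Not at hcon
    have hb : m < b := lt_of_le_of_ne (hbc ▸ inf_le_left) (Ne.symm hcon.1)
    have hc : m < c := lt_of_le_of_ne (hbc ▸ inf_le_right) (Ne.symm hcon.2)
    exact hm.1.2 (hbc ▸ le_inf (key b hb) (key c hc))

theorem lab_cov (hsm : Semimodular L) {m A B : L} (hAB : A ⋖ B) (hl : Lab m A B) :
    m ⋖ m ⊔ B := by
  have h := hsm A B m hAB
  rw [sup_eq_right.2 hl.2.1, sup_comm B m] at h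
  rcases h with h | h
  · exact h
  · exact absurd (sup_eq_left.1 h.symm) hl.2.2

theorem irr_le {m v u : L} (hm : InfIrred m) (hv : m ⋖ v) (hu : m < u) : v ≤ u := by
  rcases hv.eq_or_eq (le_inf hv.le hu.le) (inf_le_left : v ⊓ u ≤ v) with h | h
  · rcases hm.2 h with h | h
    · exact absurd h hv.ne'
    · exact absurd h hu.ne'
  · exact inf_eq_left.1 h

theorem inf_lab {m A B : L} (hAB : A ⋖ B) (hA : A ≤ m) (hB : ¬ B ≤ m) : B ⊓ m = A := by
  rcases hAB.eq_or_eq (le_inf hAB.le hA) inf_le_left with h | h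
  · exact h
  · exact absurd (inf_eq_left.1 h) hB

theorem lab_max (K : Coord L) (hsm : Semimodular L) {m A B u : L} (hAB : A ⋖ B) (hl : Lab m A B)
    (hA : A ≤ u) (hB : ¬ B ≤ u) : u ≤ m := by
  by_contra hum
  have hmu : ¬ m ≤ u := by
    intro h
    have := irr_le hl.1 (lab_cov hsm hAB hl) (lt_of_le_of_ne h fun e => hum e.ge)
    exact hB (le_sup_right.trans this)
  have e1 := inf_lab hAB hl.2.1 hl.2.2
  have e2 := inf_lab hAB hA hB
  have a1 := congrArg K.α e1
  have a2 := congrArg K.α e2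
  have b1 := congrArg K.β e1
  have b2 := congrArg K.β e2
  rw [K.infα] at a1 a2
  rw [K.infβ] at b1 b2
  have h0 := hAB.1.not_ge
  rw [K.le_iff] at hum hmu h0
  omega

theorem lab_unique (K : Coord L) (hsm : Semimodular L) {m n A B : L} (hAB : A ⋖ B)
    (hm : Lab m A B) (hn : Lab n A B) : m = n :=
  le_antisymm (lab_max K hsm hAB hn hm.2.1 hm.2.2) (lab_max K hsm hAB hm hn.2.1 hn.2.2)

theorem internal_lab [Finite L] (K : Coord L) {z B : L} (h : Internal z B) : Lab z z B := by
  obtain ⟨x, y, h⟩ := h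
  obtain ⟨m, hm⟩ := exists_lab (h.2.2.1.1.not_ge)
  have := btw_eq K h hm.2.1 hm.2.2
  exact this ▸ (this ▸ hm)

theorem internal_lab_eq (K : Coord L) {m z B : L} (h : Internal z B) (hm : Lab m z B) :
    m = z := by
  obtain ⟨x, y, h⟩ := h
  exact btw_eq K h hm.2.1 hm.2.2

theorem internal_cov {z B : L} (h : Internal z B) : z ⋖ B := by
  obtain ⟨x, y, h⟩ := h
  exact h.2.2.1

theorem exists_btw [Finite L] (hsm : Semimodular L) {x y B : L} (hx : x ⋖ B) (hy : y ⋖ B)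
    (hne : x ≠ y) (hD : ¬ x ⊓ y ⋖ y) : ∃ z, LBtw x y z B := by
  have hDx : x ⊓ y < x := lt_of_le_of_ne inf_le_left fun h =>
    cov_not_le hx hy hne (inf_eq_left.1 h)
  have hDy : x ⊓ y < y := lt_of_le_of_ne inf_le_right fun h =>
    cov_not_le hy hx hne.symm (inf_eq_right.1 h)
  obtain ⟨w, hDw, hwy⟩ := exists_le_covBy_of_lt hDy
  obtain ⟨v, hDv, hvx⟩ := exists_covBy_le_of_lt hDx
  have hDw' : x ⊓ y < w := lt_of_le_of_ne hDw fun h => hD (h ▸ hwy)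
  have hvy : ¬ v ≤ y := fun h => hDv.1.not_ge (le_inf hvx h)
  have hwx : ¬ w ≤ x := fun h => hDw'.not_ge (le_inf h hwy.le)
  have hvyB : y ⊔ v = B := by
    rcases hy.eq_or_eq (le_sup_left : y ≤ y ⊔ v) (sup_le hy.le (hvx.trans hx.le)) with h | h
    · exact absurd (sup_eq_left.1 h) hvy
    · exact h
  have hne2 : w ⊔ v ≠ B := by
    intro he
    have h := hsm (x ⊓ y) v w hDv
    rw [sup_eq_right.2 hDw, sup_comm v w, he] at h
    rcases h with h | h
    · exact h.2 hwy.1 hy.1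
    · exact absurd (hwy.1.trans hy.1) (by rw [h]; exact lt_irrefl _)
  have hc : w ⊔ v ⋖ B := by
    have h := hsm w y v hwy
    rw [hvyB] at h
    exact h.resolve_right hne2
  refine ⟨w ⊔ v, hx, hy, hc, hne, ?_, ?_, hDw.trans le_sup_left⟩
  · intro h
    exact hwx (h ▸ le_sup_left)
  · intro h
    exact hvy (h ▸ le_sup_right)

theorem LRel.refl (S : Set L) (a : L) : LRel S a a := fun _ _ _ => Iff.rfl
theorem LRel.symm {S : Set L} {a b : L} (h : LRel S a b) : LRel S b a :=
  fun m h1 h2 => (h m h1 h2).symm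
theorem LRel.trans {S : Set L} {a b c : L} (h : LRel S a b) (h' : LRel S b c) : LRel S a c :=
  fun m h1 h2 => (h m h1 h2).trans (h' m h1 h2)
theorem LRel.sup {S : Set L} {a b c d : L} (h : LRel S a b) (h' : LRel S c d) :
    LRel S (a ⊔ c) (b ⊔ d) := fun m h1 h2 => by
  rw [sup_le_iff, sup_le_iff, h m h1 h2, h' m h1 h2]

theorem rel_adj [Finite L] (K : Coord L) (hsm : Semimodular L) {S : Set L} (hS : Clo S) (B : L)
    (IH : ∀ B' < B, ∀ A ≤ B', LRel S A B' → ∀ C ≤ B', LRel S (A ⊓ C) C) :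
    ∀ D x y : L, x ⊓ y = D → x ⋖ B → y ⋖ B → LRel S x B → LRel S (x ⊓ y) y := by
  intro D
  induction D using (wellFounded_gt (α := L)).induction with
  | _ D ihD =>
  intro x y hD hx hy hr
  by_cases hxy : x = y
  · subst hxy
    rw [inf_idem]
    exact LRel.refl _ _
  by_cases hc : x ⊓ y ⋖ y
  · intro m hm hmS
    refine ⟨fun h => ?_, fun h => inf_le_right.trans h⟩
    by_contra hym
    have : x ≤ m := lab_max K hsm hc ⟨hm, h, hym⟩ inf_le_left (cov_not_le hy hx (Ne.symm hxy))
    exact hym (hy.le.trans ((hr m hm hmS).1 this))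
  obtain ⟨z, hz⟩ := exists_btw hsm hx hy hxy hc
  have hzc := hz.2.2.1
  obtain ⟨e, he⟩ := exists_lab hx.1.not_ge
  have heS : e ∈ S := by
    by_contra hcon
    exact he.2.2 ((hr e he.1 hcon).1 he.2.1)
  have hzS : z ∈ S := hS e x y z B heS hz he
  have hrz : LRel S z B := by
    intro m hm hmS
    refine ⟨fun h => ?_, fun h => hzc.le.trans h⟩
    by_contra hB
    exact hmS (btw_eq K hz h hB ▸ hzS)
  have r1 : LRel S (x ⊓ z) z := ihD (x ⊓ z) (hD ▸ btw_inf_ne K hz) x z rfl hx hzc hr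
  have r2 : LRel S (z ⊓ y) y := by
    refine ihD (z ⊓ y) ?_ z y rfl hzc hy hrz
    have := btw_inf_ne K hz.symm
    rw [inf_comm y x, inf_comm y z, hD] at this
    exact this
  have r3 := IH z hzc.1 (x ⊓ z) inf_le_right r1 (z ⊓ y) inf_le_left
  have e3 : x ⊓ z ⊓ (z ⊓ y) = x ⊓ y := by
    apply le_antisymm
    · exact le_inf (inf_le_left.trans inf_le_left) (inf_le_right.trans inf_le_right)
    · exact le_inf (le_inf inf_le_left hz.2.2.2.2.2.2) (le_inf hz.2.2.2.2.2.2 inf_le_right)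
  rw [e3] at r3
  exact r3.trans r2

theorem rel_inf_aux [Finite L] (K : Coord L) (hsm : Semimodular L) {S : Set L} (hS : Clo S) :
    ∀ B A : L, A ≤ B → LRel S A B → ∀ C ≤ B, LRel S (A ⊓ C) C := by
  intro B
  induction B using (wellFounded_lt (α := L)).induction with
  | _ B IH =>
  intro A hAB hr C hCB
  rcases hAB.eq_or_lt with rfl | hAB'
  · rw [inf_eq_right.2 hCB]
    exact LRel.refl _ _
  rcases hCB.eq_or_lt with rfl | hCB'
  · rw [inf_eq_left.2 hAB]
    exact hr
  obtain ⟨x, hAx, hx⟩ := exists_le_covBy_of_lt hAB'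
  obtain ⟨y, hCy, hy⟩ := exists_le_covBy_of_lt hCB'
  have hrx : LRel S x B := fun m hm hmS =>
    ⟨fun h => (hr m hm hmS).1 (hAx.trans h), fun h => hx.le.trans h⟩
  have hrA : LRel S A x := fun m hm hmS =>
    ⟨fun h => hx.le.trans ((hr m hm hmS).1 h), fun h => hAx.trans h⟩
  have r1 : LRel S (x ⊓ y) y := rel_adj K hsm hS B (fun B' h => IH B' h) _ x y rfl hx hy hrx
  have r2 := IH y hy.1 (x ⊓ y) inf_le_right r1 C hCy
  rw [inf_assoc, inf_eq_right.2 hCy] at r2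
  have r3 := IH x hx.1 A hAx hrA (x ⊓ C) inf_le_left
  rw [← inf_assoc, inf_eq_left.2 hAx] at r3
  exact r3.trans r2

theorem rel_inf_one [Finite L] (K : Coord L) (hsm : Semimodular L) {S : Set L} (hS : Clo S)
    {a b : L} (c : L) (h : LRel S a b) : LRel S (a ⊓ c) (b ⊓ c) := by
  have ha : LRel S a (a ⊔ b) := by
    have := (LRel.refl S a).sup h
    rwa [sup_idem] at this
  have hb : LRel S b (a ⊔ b) := h.symm.trans ha
  have r1 := rel_inf_aux K hsm hS _ a le_sup_left ha ((a ⊔ b) ⊓ c) inf_le_left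
  have r2 := rel_inf_aux K hsm hS _ b le_sup_right hb ((a ⊔ b) ⊓ c) inf_le_left
  rw [← inf_assoc, inf_sup_self] at r1
  rw [← inf_assoc, sup_comm, inf_sup_self] at r2
  rw [sup_comm] at r2
  exact r1.trans r2.symm

/-- the congruence of a closed set of labels -/
def conOf [Finite L] (K : Coord L) (hsm : Semimodular L) {S : Set L} (hS : Clo S) : LatCon L where
  r := LRel S
  refl' := LRel.refl S
  symm' _ _ h := h.symm
  trans' _ _ _ h h' := h.trans h'
  sup' _ _ _ _ h h' := h.sup h'
  inf' a b c d h h' := (rel_inf_one K hsm hS c h).trans (by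
    rw [inf_comm b c, inf_comm b d]
    exact rel_inf_one K hsm hS b h')

theorem coll_of {ψ : LatCon L} {a b m : L} (h : ψ.r a b) (ha : a ≤ m) (hb : ¬ b ≤ m) :
    Coll ψ m := by
  refine ⟨m ⊔ b, lt_of_le_of_ne le_sup_left fun e => hb (sup_eq_left.1 e.symm), ?_⟩
  have := ψ.sup' _ _ _ _ (ψ.refl' m) h
  rwa [sup_eq_left.2 ha] at this

theorem r_of_coll (hsm : Semimodular L) {ψ : LatCon L} {A B m : L} (hAB : A ⋖ B)
    (hl : Lab m A B) (h : Coll ψ m) : ψ.r A B := by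
  obtain ⟨u, hu, hr⟩ := h
  have h1 := irr_le hl.1 (lab_cov hsm hAB hl) hu
  have := ψ.inf' _ _ _ _ (ψ.refl' B) hr
  rwa [inf_lab hAB hl.2.1 hl.2.2, inf_eq_left.2 (le_sup_right.trans h1)] at this

theorem Coll.mono {ψ φ : LatCon L} (h : ψ ≤ φ) {m : L} (hm : Coll ψ m) : Coll φ m := by
  obtain ⟨u, hu, hr⟩ := hm
  exact ⟨u, hu, h _ _ hr⟩

theorem coll_conOf [Finite L] (K : Coord L) (hsm : Semimodular L) {S : Set L} (hS : Clo S) {m : L}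
    (hm : InfIrred m) : Coll (conOf K hsm hS) m ↔ m ∈ S := by
  constructor
  · rintro ⟨u, hu, hr⟩
    by_contra hmS
    exact hu.not_ge ((hr m hm hmS).1 le_rfl)
  · intro hmS
    obtain ⟨u, hu⟩ := not_isMax_iff.1 hm.1
    obtain ⟨v, hv, -⟩ := exists_covBy_le_of_lt hu
    refine ⟨v, hv.1, fun n hn hnS => ⟨fun h => ?_, fun h => hv.le.trans h⟩⟩
    refine irr_le hm hv (lt_of_le_of_ne h ?_)
    rintro rfl
    exact hnS hmS

theorem clo_coll [Finite L] (hsm : Semimodular L) (ψ : LatCon L) :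
    Clo {m | Coll ψ m} := by
  intro e x y z B he hb hl
  have h := r_of_coll hsm hb.1 hl he
  have h2 := ψ.inf' _ _ _ _ h (ψ.refl' y)
  rw [inf_eq_right.2 hb.2.1.le] at h2
  exact coll_of h2 hb.2.2.2.2.2.2 (cov_not_le hb.2.1 hb.2.2.1 hb.2.2.2.2.2.1.symm)

theorem le_of_coll [Finite L] (hsm : Semimodular L) {ψ φ : LatCon L}
    (h : ∀ m, InfIrred m → Coll ψ m → Coll φ m) : ψ ≤ φ := by
  have key : ∀ b a : L, a ≤ b → ψ.r a b → φ.r a b := by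
    intro b
    induction b using (wellFounded_lt (α := L)).induction with
    | _ b IH =>
    intro a hab hr
    rcases hab.eq_or_lt with rfl | hlt
    · exact φ.refl' _
    obtain ⟨c, hac, hcb⟩ := exists_le_covBy_of_lt hlt
    have h1 : ψ.r a c := by
      have := ψ.inf' _ _ _ _ hr (ψ.refl' c)
      rwa [inf_eq_left.2 hac, inf_eq_right.2 hcb.le] at this
    have h2 : ψ.r c b := ψ.trans' _ _ _ (ψ.symm' _ _ h1) hr
    refine φ.trans' _ _ _ (IH c hcb.1 a hac h1) ?_
    obtain ⟨m, hm⟩ := exists_lab hcb.1.not_ge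
    exact r_of_coll hsm hcb hm (h m hm.1 (coll_of h2 hm.2.1 hm.2.2))
  intro a b hr
  have h1 : ψ.r a (a ⊔ b) := by
    have := ψ.sup' _ _ _ _ (ψ.refl' a) hr
    rwa [sup_idem] at this
  have h2 : ψ.r b (a ⊔ b) := ψ.trans' _ _ _ (ψ.symm' _ _ hr) h1
  exact φ.trans' _ _ _ (key _ _ le_sup_left h1) (φ.symm' _ _ (key _ _ le_sup_right h2))

theorem coll_theta [Finite L] {m : L} (hm : InfIrred m) : Coll (thetaC m) m := by
  obtain ⟨u, hu⟩ := not_isMax_iff.1 hm.1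
  obtain ⟨v, hv, -⟩ := exists_covBy_le_of_lt hu
  refine ⟨v, hv.1, ?_⟩
  rintro ψ ⟨w, hw, hr⟩
  have := ψ.inf' _ _ _ _ hr (ψ.refl' v)
  rwa [inf_eq_left.2 hv.le, inf_eq_right.2 (irr_le hm hv hw)] at this

theorem theta_le [Finite L] {m : L} (hm : InfIrred m) {ψ : LatCon L} :
    thetaC m ≤ ψ ↔ Coll ψ m :=
  ⟨fun h => (coll_theta hm).mono h, fun h => sInf_le h⟩

theorem theta_ji [Finite L] (K : Coord L) (hsm : Semimodular L) {m : L} (hm : InfIrred m) :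
    JoinIrred (thetaC m) := by
  constructor
  · intro h
    obtain ⟨u, hu, hr⟩ := coll_theta hm
    rw [h] at hr
    let ψ : LatCon L := ⟨fun a b => a = b, fun _ => rfl, fun _ _ h => h.symm,
      fun _ _ _ h h' => h.trans h', fun _ _ _ _ h h' => by rw [h, h'],
      fun _ _ _ _ h h' => by rw [h, h']⟩
    have : ψ.r m u := (bot_le : ⊥ ≤ ψ) _ _ hr
    exact hu.ne this
  · intro y z h
    have hS : Clo {m | Coll y m ∨ Coll z m} := by
      intro e a b c B he hb hl
      rcases he with he | he
      · exact Or.inl (clo_coll hsm y e a b c B he hb hl)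
      · exact Or.inr (clo_coll hsm z e a b c B he hb hl)
    have hle : y ⊔ z ≤ conOf K hsm hS := by
      refine sup_le (le_of_coll hsm fun n hn h => ?_) (le_of_coll hsm fun n hn h => ?_)
      · exact (coll_conOf K hsm hS hn).2 (Or.inl h)
      · exact (coll_conOf K hsm hS hn).2 (Or.inr h)
    have hc : Coll (conOf K hsm hS) m := by
      rw [← theta_le hm, h]
      exact hle
    rcases (coll_conOf K hsm hS hm).1 hc with h1 | h1
    · exact Or.inl (le_antisymm ((theta_le hm).2 h1) (h ▸ le_sup_left))
    · exact Or.inr (le_antisymm ((theta_le hm).2 h1) (h ▸ le_sup_right))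

theorem exists_theta [Finite L] (hsm : Semimodular L) {x : LatCon L} (hx : JoinIrred x) :
    ∃ m, InfIrred m ∧ x = thetaC m := by
  classical
  have : Fintype L := Fintype.ofFinite L
  have hsi : SupIrred x := by
    refine ⟨fun h => hx.1 h.eq_bot, fun b c h => ?_⟩
    rcases hx.2 b c h.symm with h | h
    · exact Or.inl h.symm
    · exact Or.inr h.symm
  let T : Finset L := Finset.univ.filter fun m => InfIrred m ∧ Coll x m
  have hT : T.sup thetaC = x := by
    apply le_antisymm
    · refine Finset.sup_le fun m hm => ?_
      have := (Finset.mem_filter.1 hm).2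
      exact (theta_le this.1).2 this.2
    · refine le_of_coll hsm fun m hm hc => ?_
      rw [← theta_le hm]
      exact Finset.le_sup (f := thetaC) (Finset.mem_filter.2 ⟨Finset.mem_univ _, hm, hc⟩)
  obtain ⟨m, hm, he⟩ := hsi.finset_sup_eq hT
  exact ⟨m, (Finset.mem_filter.1 hm).2.1, he.symm⟩

theorem theta_mem_of_clo [Finite L] (K : Coord L) (hsm : Semimodular L) {S : Set L} (hS : Clo S)
    {e f : L} (he : InfIrred e) (hf : InfIrred f) (heS : e ∈ S) (h : thetaC f ≤ thetaC e) :
    f ∈ S := by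
  rw [← coll_conOf K hsm hS hf, ← theta_le hf]
  exact h.trans ((theta_le he).2 ((coll_conOf K hsm hS he).2 heS))

theorem internal_theta_le [Finite L] (K : Coord L) (hsm : Semimodular L) {x z n B : L}
    (hx : Internal x B) (hz : z ⋖ B) (hne : z ≠ x) (hn : Lab n z B) : thetaC x ≤ thetaC n := by
  obtain ⟨y, hy⟩ := internal_btw K hx hz hne
  rw [theta_le (internal_lab K hx).1]
  exact clo_coll hsm (thetaC n) n z y x B (coll_theta hn.1) hy hn

theorem internal_unique [Finite L] (K : Coord L) {z B B' : L} (h : Internal z B)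
    (h' : Internal z B') : B = B' := by
  have hi := (internal_lab K h).1
  exact le_antisymm (irr_le hi (internal_cov h) (internal_cov h').1)
    (irr_le hi (internal_cov h') (internal_cov h).1)

theorem cover_form [Finite L] (K : Coord L) (hsm : Semimodular L) {f e : L}
    (hf : InfIrred f) (he : InfIrred e) (hlt : JCovBy (thetaC f) (thetaC e)) :
    ∃ B h n, Internal f B ∧ h ⋖ B ∧ ¬ Internal h B ∧ Lab n h B ∧ thetaC e = thetaC n := by
  let S : Set L := {g | InfIrred g ∧ thetaC g ≤ thetaC e ∧ (thetaC e ≤ thetaC g ∨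
    ∃ B h n, Internal g B ∧ h ⋖ B ∧ ¬ Internal h B ∧ Lab n h B ∧ thetaC n ≤ thetaC e)}
  have hS : Clo S := by
    rintro g x y z B ⟨hg, hge, hor⟩ hb hl
    have hzi : Internal z B := ⟨x, y, hb⟩
    have hzl := internal_lab K hzi
    have hzg : thetaC z ≤ thetaC g :=
      internal_theta_le K hsm hzi hb.1 hb.2.2.2.2.1.symm hl
    refine ⟨hzl.1, hzg.trans hge, ?_⟩
    by_cases hxi : Internal x B
    · have hgx := internal_lab_eq K hxi hl
      subst hgx
      rcases hor with hor | ⟨B', h, n, h1, h2, h3, h4, h5⟩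
      · exact Or.inl (hor.trans
          (internal_theta_le K hsm hxi hb.2.2.1 hb.2.2.2.2.1 hzl))
      · have := internal_unique K hxi h1
        subst this
        exact Or.inr ⟨B, h, n, hzi, h2, h3, h4, h5⟩
    · exact Or.inr ⟨B, x, g, hzi, hb.1, hxi, hl, hge⟩
  have heS : e ∈ S := ⟨he, le_rfl, Or.inl le_rfl⟩
  obtain ⟨-, -, hor⟩ := theta_mem_of_clo K hsm hS he hf heS hlt.2.2.1.le
  rcases hor with hor | ⟨B, h, n, h1, h2, h3, h4, h5⟩
  · exact absurd hor hlt.2.2.1.not_ge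
  refine ⟨B, h, n, h1, h2, h3, h4, ?_⟩
  have hhf : h ≠ f := by
    rintro rfl
    exact h3 h1
  have hfn : thetaC f ≤ thetaC n := internal_theta_le K hsm h1 h2 hhf h4
  have hnf : ¬ thetaC n ≤ thetaC f := by
    intro hle
    let T : Set L := {g | ∃ B', Internal g B' ∧ B' ≤ B}
    have hT : Clo T := by
      rintro g x y z B1 ⟨B', hg, hB'⟩ hb hl
      refine ⟨B1, ⟨x, y, hb⟩, le_trans ?_ hB'⟩
      have c := lab_cov hsm hb.1 hl
      exact le_sup_right.trans (irr_le hl.1 c (internal_cov hg).1)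
    obtain ⟨B', hn, hB'⟩ := theta_mem_of_clo K hsm hT hf h4.1 ⟨B, h1, le_rfl⟩ hle
    have c := lab_cov hsm h2 h4
    have hBB : B ≤ B' := le_sup_right.trans (irr_le h4.1 c (internal_cov hn).1)
    have hBe := le_antisymm hBB hB'
    subst hBe
    have hh : h = n := by
      by_contra hne
      exact cov_not_le h2 (internal_cov hn) hne h4.2.1
    exact h3 (hh ▸ hn)
  by_contra hne
  exact hlt.2.2.2 (thetaC n) (theta_ji K hsm h4.1) (lt_of_le_not_ge hfn hnf)
    (lt_of_le_of_ne h5 (Ne.symm hne))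

theorem seg_chain {C : Set L} (hC : IsChain (· ≤ ·) C) (x y : L) :
    (∀ c ∈ C, c ≤ x → c ≤ y) ∨ (∀ c ∈ C, c ≤ y → c ≤ x) := by
  by_contra hcon
  push Not at hcon
  obtain ⟨⟨c, hc, h1, h2⟩, d, hd, h3, h4⟩ := hcon
  rcases hC.total hc hd with h | h
  · exact h2 (h.trans h3)
  · exact h4 (h.trans h1)

theorem seg_card [Finite L] {C : Set L} (hC : IsChain (· ≤ ·) C) (x y : L) :
    ({c ∈ C | c ≤ x}.ncard ≤ {c ∈ C | c ≤ y}.ncard ↔ ∀ c ∈ C, c ≤ x → c ≤ y) := by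
  constructor
  · intro h
    rcases seg_chain hC x y with h1 | h1
    · exact h1
    · have hs : {c ∈ C | c ≤ y} ⊆ {c ∈ C | c ≤ x} := fun c hc => ⟨hc.1, h1 c hc.1 hc.2⟩
      have := Set.eq_of_subset_of_ncard_le hs h (Set.toFinite _)
      intro c hc hx
      have hm : c ∈ {c ∈ C | c ≤ y} := this ▸ ⟨hc, hx⟩
      exact hm.2
  · intro h
    exact Set.ncard_le_ncard (fun c hc => ⟨hc.1, h c hc.1 hc.2⟩) (Set.toFinite _)

theorem seg_inf [Finite L] {C : Set L} (hC : IsChain (· ≤ ·) C) (x y : L) :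
    {c ∈ C | c ≤ x ⊓ y}.ncard = min {c ∈ C | c ≤ x}.ncard {c ∈ C | c ≤ y}.ncard := by
  rcases seg_chain hC x y with h | h
  · rw [min_eq_left ((seg_card hC x y).2 h)]
    congr 1
    ext c
    exact ⟨fun hc => ⟨hc.1, hc.2.trans inf_le_left⟩,
      fun hc => ⟨hc.1, le_inf hc.2 (h c hc.1 hc.2)⟩⟩
  · rw [min_eq_right ((seg_card hC y x).2 h)]
    congr 1
    ext c
    exact ⟨fun hc => ⟨hc.1, hc.2.trans inf_le_right⟩,
      fun hc => ⟨hc.1, le_inf (h c hc.1 hc.2) hc.2⟩⟩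

theorem exists_ji [OrderBot L] [Finite L] {x y : L} (h : ¬ x ≤ y) :
    ∃ j, JoinIrred j ∧ j ≤ x ∧ ¬ j ≤ y := by
  obtain ⟨m, hm⟩ := (Set.toFinite {u : L | u ≤ x ∧ ¬ u ≤ y}).exists_minimal ⟨x, le_refl x, h⟩
  refine ⟨m, ⟨?_, ?_⟩, hm.1⟩
  · rintro rfl
    exact hm.1.2 bot_le
  · intro b c hbc
    by_contra hcon
    push Not at hcon
    have key : ∀ u, u < m → u ≤ y := by
      intro u hu
      by_contra hB
      exact hu.not_ge (hm.2 ⟨hu.le.trans hm.1.1, hB⟩ hu.le)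
    have hb : b < m := lt_of_le_of_ne (hbc ▸ le_sup_left) (Ne.symm hcon.1)
    have hc : c < m := lt_of_le_of_ne (hbc ▸ le_sup_right) (Ne.symm hcon.2)
    exact hm.1.2 (hbc ▸ sup_le (key b hb) (key c hc))

theorem exists_coord [OrderBot L] [Finite L] (h : Slim L) : Nonempty (Coord L) := by
  obtain ⟨C₁, C₂, h1, h2, hJ⟩ := h
  refine ⟨⟨fun x => {c ∈ C₁ | c ≤ x}.ncard, fun x => {c ∈ C₂ | c ≤ x}.ncard, ?_,
    seg_inf h1, seg_inf h2⟩⟩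
  intro x y
  rw [seg_card h1, seg_card h2]
  refine ⟨fun h => ⟨fun c _ hc => hc.trans h, fun c _ hc => hc.trans h⟩, ?_⟩
  rintro ⟨ha, hb⟩
  by_contra hxy
  obtain ⟨j, hj, hjx, hjy⟩ := exists_ji hxy
  have hm : j ∈ C₁ ∪ C₂ := hJ ▸ hj
  rcases hm with hm | hm
  · exact hjy (ha j hm hjx)
  · exact hjy (hb j hm hjx)

end SlimProof

/-- The congruence lattice of a slim semimodular lattice satisfies the Two-cover Property:
every join-irreducible congruence has at most two covers in the poset of join-irreducible
congruences. -/
theorem conLattice_of_slim_semimodular_twoCoverProperty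
    (L : Type*) [Lattice L] [OrderBot L] [Fintype L]
    (hslim : Slim L) (hsm : Semimodular L) :
    TwoCoverProperty (LatCon L) := by
  obtain ⟨K⟩ := exists_coord hslim
  intro x y z w hy hz hw
  obtain ⟨f, hf, rfl⟩ := exists_theta hsm hy.1
  obtain ⟨e1, he1, rfl⟩ := exists_theta hsm hy.2.1
  obtain ⟨e2, he2, rfl⟩ := exists_theta hsm hz.2.1
  obtain ⟨e3, he3, rfl⟩ := exists_theta hsm hw.2.1
  obtain ⟨B, h1, n1, i1, c1, p1, l1, q1⟩ := cover_form K hsm hf he1 hy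
  obtain ⟨B2, h2, n2, i2, c2, p2, l2, q2⟩ := cover_form K hsm hf he2 hz
  obtain ⟨B3, h3, n3, i3, c3, p3, l3, q3⟩ := cover_form K hsm hf he3 hw
  have hB2 := internal_unique K i1 i2
  have hB3 := internal_unique K i1 i3
  subst hB2 hB3
  rw [q1, q2, q3]
  by_cases h12 : h1 = h2
  · subst h12
    exact Or.inl (by rw [lab_unique K hsm c1 l1 l2])
  by_cases h13 : h1 = h3
  · subst h13
    exact Or.inr (Or.inl (by rw [lab_unique K hsm c1 l1 l3]))
  by_cases h23 : h2 = h3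
  · subst h23
    exact Or.inr (Or.inr (by rw [lab_unique K hsm c2 l2 l3]))
  rcases three_middle K c1 c2 c3 h12 h13 h23 with h | h | h
  · exact absurd h p1
  · exact absurd h p2
  · exact absurd h p3
end
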